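/- arXiv:0804.4842 — 3 statements merged into one kernel-verified Lean document; each statement's English description precedes it below -/
import Mathlib

section
/- Let the DAE system (Σ) given by f_1,…,f_r be quasi-regular at a minimal prime differential ideal 𝔓 containing f_1,…,f_r. Then for every positive integer i, the polynomials f_1^{[i−1]},…,f_r^{[i−1]} (all total derivatives of f_1,…,f_r up to order i−1) form a regular sequence in the local ring B_{i−1+e} and the ideal they generate in B_{i−1+e} is prime. -/
set_option synthInstance.maxHeartbeats 1000000
set_option maxHeartbeats 4000000

noncomputable section

namespace DAE

open MvPolynomial

/-- The ring of differential polynomials `K{X_1,…,X_n}`: the polynomial ring in the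
variables `X_j^{(l)}`, `1 ≤ j ≤ n`, `l ∈ ℕ`. -/
abbrev DP (K : Type) [Field K] (n : ℕ) : Type := MvPolynomial (Fin n × ℕ) K

variable {K : Type} [Field K] {n : ℕ}

/-- `δ : K → K` is a derivation of the field `K`. -/
structure IsDeriv (K : Type) [Field K] (δ : K → K) : Prop where
  map_add : ∀ a b, δ (a + b) = δ a + δ b
  leibniz : ∀ a b, δ (a * b) = a * δ b + b * δ a

/-- `D` is the total derivation of `K{X}` extending the derivation `δ` of `K`, with
`D X_j^{(l)} = X_j^{(l+1)}`. The `p`-th total derivative of `g` is `D^[p] g`. -/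
structure IsTotalDeriv (K : Type) [Field K] (n : ℕ) (δ : K → K) (D : DP K n → DP K n) : Prop where
  map_add : ∀ f g, D (f + g) = D f + D g
  leibniz : ∀ f g, D (f * g) = f * D g + g * D f
  map_C : ∀ a : K, D (C a) = C (δ a)
  map_X : ∀ (j : Fin n) (l : ℕ), D (X (j, l)) = X (j, l + 1)

/-- the maximal order of derivation of `X_j` appearing in `f` (`0` when absent) -/
def ordIn (f : DP K n) (j : Fin n) : ℕ :=
  (f.vars.filter fun v => v.1 = j).sup fun v => v.2

/-- some derivative of `X_j` appears in `f` -/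
def appearsIn (f : DP K n) (j : Fin n) : Prop :=
  (f.vars.filter fun v => v.1 = j).Nonempty

instance {K : Type} [Field K] {n : ℕ} (f : DP K n) (j : Fin n) : Decidable (appearsIn f j) := by
  unfold appearsIn; infer_instance

/-- the order of `f`: maximal order of derivation of a variable appearing in `f` -/
def ordOf (f : DP K n) : ℕ := f.vars.sup fun v => v.2

/-- `I` is a differential ideal (stable under the total derivation `D`) -/
def IsDiffIdeal (D : DP K n → DP K n) (I : Ideal (DP K n)) : Prop := ∀ g ∈ I, D g ∈ I

/-- the differential ideal `[f_1,…,f_r]` generated by `f_1,…,f_r` -/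
def diffIdealGen (D : DP K n → DP K n) {r : ℕ} (f : Fin r → DP K n) : Ideal (DP K n) :=
  sInf {I | (∀ t, f t ∈ I) ∧ IsDiffIdeal D I}

/-- `𝔓` is a prime differential ideal, minimal among those containing `f_1,…,f_r` -/
def IsMinimalPrimeDiff (D : DP K n → DP K n) {r : ℕ} (f : Fin r → DP K n)
    (𝔓 : Ideal (DP K n)) : Prop :=
  𝔓.IsPrime ∧ IsDiffIdeal D 𝔓 ∧ (∀ t, f t ∈ 𝔓) ∧
    ∀ Q : Ideal (DP K n), Q.IsPrime → IsDiffIdeal D Q → (∀ t, f t ∈ Q) → Q ≤ 𝔓 → Q = 𝔓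

/-- the polynomial ring `A_i := K[X^{[i]}]` -/
abbrev AP (K : Type) [Field K] (n i : ℕ) : Type := MvPolynomial (Fin n × Fin (i + 1)) K

/-- the inclusion `A_i ↪ K{X}` -/
def inclA (K : Type) [Field K] (n i : ℕ) : AP K n i →+* DP K n :=
  (rename fun v : Fin n × Fin (i + 1) => ((v.1, (v.2 : ℕ)) : Fin n × ℕ)).toRingHom

/-- the truncation `K{X} → A_i` (a retraction of `inclA`, exact on polynomials of
order at most `i`) -/
def truncA (K : Type) [Field K] (n i : ℕ) : DP K n →+* AP K n i :=
  (aeval fun v : Fin n × ℕ =>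
    if h : v.2 < i + 1 then (X (v.1, ⟨v.2, h⟩) : AP K n i) else 0).toRingHom

/-- the contraction `A_i ∩ 𝔓` -/
def Pc {K : Type} [Field K] {n : ℕ} (i : ℕ) (𝔓 : Ideal (DP K n)) : Ideal (AP K n i) :=
  𝔓.comap (inclA K n i)

instance {K : Type} [Field K] {n : ℕ} (i : ℕ) (𝔓 : Ideal (DP K n)) [𝔓.IsPrime] :
    (Pc i 𝔓).IsPrime := Ideal.IsPrime.comap _

/-- the local ring `B_i`: the localization of `A_i` at the prime `A_i ∩ 𝔓` -/
abbrev BL (K : Type) [Field K] (n : ℕ) (i : ℕ) (𝔓 : Ideal (DP K n)) [𝔓.IsPrime] : Type :=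
  Localization.AtPrime (Pc (K := K) (n := n) i 𝔓)

/-- the transition map `A_i → A_{i'}` for `i ≤ i'` -/
def renAA (K : Type) [Field K] (n : ℕ) {i i' : ℕ} (h : i ≤ i') : AP K n i →+* AP K n i' :=
  (rename (Prod.map (id : Fin n → Fin n) (Fin.castLE (by omega)))).toRingHom

lemma inclA_comp_renAA (K : Type) [Field K] (n : ℕ) {i i' : ℕ} (h : i ≤ i') :
    (inclA K n i').comp (renAA K n h) = inclA K n i := by
  ext p
  · simp [inclA, renAA]
  · simp [inclA, renAA]

lemma Pc_eq_comap {K : Type} [Field K] {n : ℕ} (𝔓 : Ideal (DP K n)) {i i' : ℕ} (h : i ≤ i') :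
    Pc i 𝔓 = (Pc i' 𝔓).comap (renAA K n h) := by
  unfold Pc
  rw [Ideal.comap_comap, inclA_comp_renAA]

/-- the canonical local map `B_i → B_{i'}`, `i ≤ i'` -/
def ringBB {K : Type} [Field K] {n : ℕ} (𝔓 : Ideal (DP K n)) [𝔓.IsPrime] {i i' : ℕ}
    (h : i ≤ i') : BL K n i 𝔓 →+* BL K n i' 𝔓 :=
  Localization.localRingHom _ _ (renAA K n h) (Pc_eq_comap 𝔓 h)

/-- the canonical local map `B_i → K{X}_𝔓` -/
def ringBP {K : Type} [Field K] {n : ℕ} (𝔓 : Ideal (DP K n)) [𝔓.IsPrime] (i : ℕ) :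
    BL K n i 𝔓 →+* Localization.AtPrime 𝔓 :=
  Localization.localRingHom _ _ (inclA K n i) rfl

/-- the image in `B_j` of a differential polynomial (of order `≤ j`) -/
def bElem {K : Type} [Field K] {n : ℕ} (𝔓 : Ideal (DP K n)) [𝔓.IsPrime] (j : ℕ)
    (g : DP K n) : BL K n j 𝔓 :=
  algebraMap (AP K n j) (BL K n j 𝔓) (truncA K n j g)

/-- the prolongation ideal `Δ_m = (f_1^{[m-1]},…,f_r^{[m-1]})` in the ring `B_j` -/
def prolong (D : DP K n → DP K n) {r : ℕ} (f : Fin r → DP K n)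
    (𝔓 : Ideal (DP K n)) [𝔓.IsPrime] (m j : ℕ) : Ideal (BL K n j 𝔓) :=
  Ideal.span {x | ∃ (t : Fin r) (s : ℕ) (a : AP K n j),
    s < m ∧ inclA K n j a = D^[s] (f t) ∧ x = algebraMap (AP K n j) (BL K n j 𝔓) a}

/-- `Δ := 𝔓·K{X}_𝔓` -/
def bigDelta {K : Type} [Field K] {n : ℕ} (𝔓 : Ideal (DP K n)) [𝔓.IsPrime] :
    Ideal (Localization.AtPrime 𝔓) :=
  Ideal.map (algebraMap (DP K n) (Localization.AtPrime 𝔓)) 𝔓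

instance {K : Type} [Field K] {n : ℕ} (𝔓 : Ideal (DP K n)) [𝔓.IsPrime] :
    IsDomain (DP K n ⧸ 𝔓) := Ideal.Quotient.isDomain 𝔓

/-- `𝕂 := Frac(K{X}/𝔓)`, the residual field of `𝔓` -/
abbrev KK (K : Type) [Field K] (n : ℕ) (𝔓 : Ideal (DP K n)) [𝔓.IsPrime] : Type :=
  FractionRing (DP K n ⧸ 𝔓)

/-- the canonical map `K{X} → 𝕂` -/
def toKK {K : Type} [Field K] {n : ℕ} (𝔓 : Ideal (DP K n)) [𝔓.IsPrime] :
    DP K n →+* KK K n 𝔓 :=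
  (algebraMap (DP K n ⧸ 𝔓) (KK K n 𝔓)).comp (Ideal.Quotient.mk 𝔓)

/-- the Jacobian matrix of `f_1^{[i-1]},…,f_r^{[i-1]}` with respect to `X^{[i-1+e]}`,
with entries taken in `𝕂` (full row rank over the domain `A_{i-1+e}/(A_{i-1+e}∩𝔓)` is
equivalent to full rank over its fraction field, hence over `𝕂`). -/
def qrJac (D : DP K n → DP K n) {r : ℕ} (f : Fin r → DP K n)
    (𝔓 : Ideal (DP K n)) [𝔓.IsPrime] (e i : ℕ) :
    Matrix (Fin r × Fin i) (Fin n × Fin (i + e)) (KK K n 𝔓) :=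
  fun p q => toKK 𝔓 (pderiv (q.1, (q.2 : ℕ)) (D^[(p.2 : ℕ)] (f p.1)))

/-- the system `f_1,…,f_r` is quasi-regular at `𝔓` -/
def IsQuasiRegularAt (D : DP K n → DP K n) {r : ℕ} (f : Fin r → DP K n)
    (𝔓 : Ideal (DP K n)) [𝔓.IsPrime] (e : ℕ) : Prop :=
  ∀ i : ℕ, 1 ≤ i → (qrJac D f 𝔓 e i).rank = r * i

/-- the entry of the pseudo-Jacobian `𝔍_{k,i}` in block `(p,q)`, row `t := p.2`,
column `j := q.2`: `∂ f_t^{(i-e+1+p)} / ∂ X_j^{(i+1+q)}` -/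
def jEntry (D : DP K n → DP K n) {r : ℕ} (f : Fin r → DP K n) (e i : ℕ) {k : ℕ}
    (p : Fin k × Fin r) (q : Fin k × Fin n) : DP K n :=
  pderiv (q.2, i + 1 + (q.1 : ℕ)) (D^[i + 1 - e + (p.1 : ℕ)] (f p.2))

/-- the pseudo-Jacobian `𝔍_{k,i}` over `𝕂` -/
def Jmat (D : DP K n → DP K n) {r : ℕ} (f : Fin r → DP K n)
    (𝔓 : Ideal (DP K n)) [𝔓.IsPrime] (e k i : ℕ) :
    Matrix (Fin k × Fin r) (Fin k × Fin n) (KK K n 𝔓) :=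
  fun p q => toKK 𝔓 (jEntry D f e i p q)

/-- `μ_{k,i} := kr − rank_𝕂 𝔍_{k,i}` -/
def mu (D : DP K n → DP K n) {r : ℕ} (f : Fin r → DP K n)
    (𝔓 : Ideal (DP K n)) [𝔓.IsPrime] (e k i : ℕ) : ℕ :=
  k * r - (Jmat D f 𝔓 e k i).rank

/-- the pseudo-Jacobian `𝔍_{k,i}` over the ring `B_j / Δ_m` -/
def JmatOver (D : DP K n → DP K n) {r : ℕ} (f : Fin r → DP K n)
    (𝔓 : Ideal (DP K n)) [𝔓.IsPrime] (e k i m j : ℕ) :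
    Matrix (Fin k × Fin r) (Fin k × Fin n) (BL K n j 𝔓 ⧸ prolong D f 𝔓 m j) :=
  fun p q => Ideal.Quotient.mk _ (bElem 𝔓 j (jEntry D f e i p q))

/-- the standing rank hypothesis: for every `k,i` the rank of `𝔍_{k,i}` over the
domain `B_{i+k+s}/Δ_{i-1+e+k+s}` does not depend on `s` and equals its rank over `𝕂` -/
def StandingRank (D : DP K n → DP K n) {r : ℕ} (f : Fin r → DP K n)
    (𝔓 : Ideal (DP K n)) [𝔓.IsPrime] (e : ℕ) : Prop :=
  ∀ k i s : ℕ, 1 ≤ k → e - 1 ≤ i →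
    (JmatOver D f 𝔓 e k i (i - 1 + e + k + s) (i + k + s)).rank = (Jmat D f 𝔓 e k i).rank

/-- the Jacobi number of a matrix of natural numbers -/
def jacobiN {ι κ : Type} [Fintype ι] [Fintype κ] [DecidableEq ι] [DecidableEq κ]
    (M : ι → κ → ℕ) : ℕ :=
  Finset.univ.sup fun τ : {τ : ι → κ // Function.Injective τ} => ∑ i, M i (τ.1 i)

/-- the Jacobi number of a matrix with entries in `ℕ₀ ∪ {−∞}` -/
def jacobiE {ι κ : Type} [Fintype ι] [Fintype κ] [DecidableEq ι] [DecidableEq κ]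
    (M : ι → κ → WithBot ℕ) : WithBot ℕ :=
  Finset.univ.sup fun τ : {τ : ι → κ // Function.Injective τ} => ∑ i, M i (τ.1 i)

/-- the (finite) transcendence degree of `E` over `F` equals `d` -/
def HasTrdeg (F E : Type) [CommRing F] [CommRing E] [Algebra F E] (d : ℕ) : Prop :=
  ∃ s : Finset E, IsTranscendenceBasis F (fun x : {x : E // x ∈ s} => x.1) ∧ s.card = d

end DAE

namespace DAEaux

section
open IsLocalRing
universe u

theorem aux_qreg {R : Type*} [CommRing R] [IsRegularLocalRing R] {ι : Type*} [Fintype ι]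
    (x : ι → R) (hx : ∀ i, x i ∈ maximalIdeal R)
    (hind : ∀ c : ι → R, ∑ i, c i * x i ∈ (maximalIdeal R)^2 → ∀ i, c i ∈ maximalIdeal R) :
    IsRegularLocalRing (R ⧸ Ideal.span (Set.range x)) ∧
      ∃ d : ℕ, ringKrullDim (R ⧸ Ideal.span (Set.range x)) ≤ d ∧
        ((Fintype.card ι + d : ℕ) : WithBot ℕ∞) = ringKrullDim R := by
  classical
  set I := Ideal.span (Set.range x) with hI
  have hIm : I ≤ maximalIdeal R := by
    rw [hI, Ideal.span_le]; rintro _ ⟨i, rfl⟩; exact hx i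
  have hne : I ≠ ⊤ := fun h => Ideal.IsPrime.ne_top' (top_le_iff.mp (h ▸ hIm))
  have : Nontrivial (R ⧸ I) := Ideal.Quotient.nontrivial_iff.mpr hne
  have : IsLocalRing (R ⧸ I) := IsLocalRing.of_surjective' _ Ideal.Quotient.mk_surjective
  let v : ι → CotangentSpace R := fun i => (maximalIdeal R).toCotangent ⟨x i, hx i⟩
  have hv : LinearIndependent (ResidueField R) v := by
    rw [Fintype.linearIndependent_iff]
    intro g hg
    choose c hc using fun i => residue_surjective (g i)
    have h1 : (maximalIdeal R).toCotangent (∑ i, c i • (⟨x i, hx i⟩ : maximalIdeal R)) = 0 := by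
      rw [map_sum, ← hg]
      refine Finset.sum_congr rfl fun i _ => ?_
      rw [map_smul, ← hc]; rfl
    rw [Ideal.toCotangent_eq_zero] at h1
    have h2 := hind c (by simpa using h1)
    intro i
    rw [← hc, residue_eq_zero_iff]
    exact h2 i
  set W := Submodule.span (ResidueField R) (Set.range v) with hW
  obtain ⟨W', hWW⟩ := Submodule.exists_isCompl W
  have hfr : Fintype.card ι + Module.finrank (ResidueField R) W' =
      Module.finrank (ResidueField R) (CotangentSpace R) := by
    rw [← Submodule.finrank_add_eq_of_isCompl hWW, hW, finrank_span_eq_card hv]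
  let b := Module.finBasis (ResidueField R) W'
  choose y hy using fun j => (maximalIdeal R).toCotangent_surjective (b j : CotangentSpace R)
  let x' : ι → maximalIdeal R := fun i => ⟨x i, hx i⟩
  have hspan : Submodule.span R (Set.range x' ∪ Set.range y) = ⊤ := by
    rw [← CotangentSpace.span_image_eq_top_iff, Set.image_union, Submodule.span_union,
      ← Set.range_comp, ← Set.range_comp, ← hWW.sup_eq_top]
    congr 1
    have : ((maximalIdeal R).toCotangent ∘ y) = W'.subtype ∘ b := by
      ext j; exact hy j
    rw [this, Set.range_comp, Submodule.span_image, b.span_eq]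
    simp
  have hm : maximalIdeal R = Ideal.span (Set.range x ∪ Set.range fun j => (y j : R)) := by
    have := congrArg (Submodule.map (maximalIdeal R).subtype) hspan
    rw [Submodule.map_span, Set.image_union, ← Set.range_comp, ← Set.range_comp,
      Submodule.map_top, Submodule.range_subtype] at this
    exact this.symm
  have hm' : maximalIdeal (R ⧸ I) =
      Ideal.span (Set.range fun j => Ideal.Quotient.mk I (y j : R)) := by
    have : IsLocalHom (Ideal.Quotient.mk I) :=
      IsLocalHom.of_surjective _ Ideal.Quotient.mk_surjective
    rw [← Ideal.map_comap_of_surjective _ Ideal.Quotient.mk_surjective (maximalIdeal (R ⧸ I)),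
      maximalIdeal_comap]
    conv_lhs => rw [hm]
    rw [Ideal.span_union, Ideal.map_sup, ← hI, Ideal.map_quotient_self,
      bot_sup_eq, Ideal.map_span, ← Set.range_comp]
    rfl
  have h1 : (maximalIdeal (R ⧸ I)).spanFinrank ≤ Module.finrank (ResidueField R) W' := by
    rw [hm']
    refine (Submodule.spanFinrank_span_le_ncard_of_finite (Set.finite_range _)).trans ?_
    rw [← Nat.card_coe_set_eq]
    exact (Finite.card_range_le _).trans (by simp)
  have h2 := ringKrullDim_le_ringKrullDim_quotient_add_spanFinrank I
    (hIm.trans (IsLocalRing.ringJacobson_eq_maximalIdeal R).ge)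
  have h3 : I.spanFinrank ≤ Fintype.card ι := by
    refine (Submodule.spanFinrank_span_le_ncard_of_finite (Set.finite_range _)).trans ?_
    rw [← Nat.card_coe_set_eq]
    exact (Finite.card_range_le _).trans (by simp)
  rw [← (IsRegularLocalRing.iff_finrank_cotangentSpace R).mp inferInstance, ← hfr] at h2
  have h4 : ((Module.finrank (ResidueField R) W' : ℕ) : WithBot ℕ∞) ≤ ringKrullDim (R ⧸ I) := by
    generalize ringKrullDim (R ⧸ I) = d at h2 ⊢
    induction d with
    | bot => simp at h2
    | coe d =>
      induction d with
      | top => exact le_top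
      | coe d =>
        norm_cast at h2 ⊢
        omega
  refine ⟨IsRegularLocalRing.of_spanFinrank_maximalIdeal_le _ (le_trans (by exact_mod_cast h1) h4),
    Module.finrank (ResidueField R) W', ?_, ?_⟩
  · exact (ringKrullDim_le_spanFinrank_maximalIdeal _).trans (by exact_mod_cast h1)
  · rw [← (IsRegularLocalRing.iff_finrank_cotangentSpace R).mp inferInstance, ← hfr]

theorem aux_domain (d : ℕ) : ∀ (R : Type u) [CommRing R] [IsRegularLocalRing R],
    ringKrullDim R ≤ d → IsDomain R := by
  induction d with
  | zero =>
    intro R _ _ h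
    have h1 := (IsRegularLocalRing.iff_finrank_cotangentSpace R).mp inferInstance
    rw [← h1] at h
    have h2 : Module.finrank (ResidueField R) (CotangentSpace R) = 0 := by
      have : Module.finrank (ResidueField R) (CotangentSpace R) ≤ 0 := by exact_mod_cast h
      omega
    rw [finrank_cotangentSpace_eq_zero_iff] at h2
    exact h2.isDomain
  | succ d ih =>
    intro R _ _ h
    classical
    have key : ∀ x ∈ maximalIdeal R, x ∉ (maximalIdeal R)^2 → (Ideal.span {x}).IsPrime := by
      intro x hx hx2
      obtain ⟨hreg, d', h1, h2⟩ := aux_qreg (R := R) (ι := Unit) (fun _ => x) (fun _ => hx) (by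
        intro c hc i
        by_contra hu
        have hu : IsUnit (c i) := by simpa using hu
        apply hx2
        have : c i * x ∈ (maximalIdeal R)^2 := by simpa using hc
        exact (Ideal.unit_mul_mem_iff_mem _ hu).mp this)
      rw [Set.range_const] at hreg h1
      rw [← h2] at h
      have h3 : d' ≤ d := by
        have : Fintype.card Unit + d' ≤ d + 1 := by exact_mod_cast h
        simp at this; omega
      have := ih (R ⧸ Ideal.span {x}) (h1.trans (by exact_mod_cast h3))
      exact (Ideal.Quotient.isDomain_iff_prime _).mp this
    by_cases hf : IsField R
    · exact hf.isDomain
    have hm0 : maximalIdeal R ≠ ⊥ := fun h => hf (IsLocalRing.isField_iff_maximalIdeal_eq.mpr h)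
    by_cases hmm : maximalIdeal R ∈ minimalPrimes R
    · exfalso
      have h0 := Ideal.height_eq_zero_iff.mpr hmm
      have h1 := IsLocalRing.maximalIdeal_height_eq_ringKrullDim (R := R)
      rw [h0, ← (IsRegularLocalRing.iff_finrank_cotangentSpace R).mp inferInstance] at h1
      have h2 : 0 = Module.finrank (ResidueField R) (CotangentSpace R) := by exact_mod_cast h1
      exact hf (finrank_cotangentSpace_eq_zero_iff.mp h2.symm)
    have hfin := minimalPrimes.finite_of_isNoetherianRing R
    obtain ⟨x, hx, hx2, hxp⟩ : ∃ x ∈ maximalIdeal R, x ∉ (maximalIdeal R)^2 ∧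
        ∀ p ∈ minimalPrimes R, x ∉ p := by
      by_contra! hcon
      have hsub : (maximalIdeal R : Set R) ⊆
          ⋃ i ∈ ((insert ((maximalIdeal R)^2) hfin.toFinset : Finset (Ideal R)) : Set (Ideal R)),
            ((id i : Ideal R) : Set R) := by
        intro x hx
        by_cases hx2 : x ∈ (maximalIdeal R)^2
        · simp only [Set.mem_iUnion]
          exact ⟨_, by simp, hx2⟩
        · obtain ⟨p, hp, hxp⟩ := hcon x hx hx2
          simp only [Set.mem_iUnion]
          exact ⟨p, by simp [hp], hxp⟩
      rw [Ideal.subset_union_prime ((maximalIdeal R)^2) ((maximalIdeal R)^2)] at hsub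
      · obtain ⟨p, hp, hle⟩ := hsub
        rw [Finset.mem_insert] at hp
        rcases hp with rfl | hp
        · apply hm0
          refine Submodule.eq_bot_of_le_smul_of_le_jacobson_bot (maximalIdeal R) (maximalIdeal R)
            (IsNoetherian.noetherian _) ?_ ?_
          · rw [smul_eq_mul, ← pow_two]; exact hle
          · exact (IsLocalRing.jacobson_eq_maximalIdeal _ bot_ne_top).ge
        · have hp : p ∈ minimalPrimes R := by simpa using hp
          have : p.IsPrime := hp.1.1
          have : p = maximalIdeal R := le_antisymm (IsLocalRing.le_maximalIdeal this.ne_top) hle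
          exact hmm (this ▸ hp)
      · intro i hi hi1 _
        rw [Finset.mem_insert] at hi
        have hp : i ∈ minimalPrimes R := by simpa using hi.resolve_left hi1
        exact hp.1.1
    have hpx := key x hx hx2
    obtain ⟨q, hq, hqx⟩ := Ideal.exists_minimalPrimes_le (I := ⊥) (J := Ideal.span {x}) bot_le
    have hqp : q.IsPrime := hq.1.1
    have hxq : x ∉ q := hxp q hq
    have hq0 : q = ⊥ := by
      refine Submodule.eq_bot_of_le_smul_of_le_jacobson_bot (maximalIdeal R) q
            (IsNoetherian.noetherian _) ?_ (IsLocalRing.jacobson_eq_maximalIdeal _ bot_ne_top).ge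
      intro z hz
      obtain ⟨a, rfl⟩ := Ideal.mem_span_singleton'.mp (hqx hz)
      rw [smul_eq_mul, mul_comm a x]
      exact Ideal.mul_mem_mul hx ((hqp.mem_or_mem hz).resolve_right hxq)
    rw [hq0] at hqp
    have : NoZeroDivisors R := ⟨fun {a b} hab => by
      have := hqp.mem_or_mem (x := a) (y := b) (by simp [hab])
      simpa using this⟩
    exact NoZeroDivisors.to_isDomain R

theorem aux_prime {R : Type u} [CommRing R] [IsRegularLocalRing R] {ι : Type*} [Fintype ι]
    (x : ι → R) (hx : ∀ i, x i ∈ maximalIdeal R)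
    (hind : ∀ c : ι → R, ∑ i, c i * x i ∈ (maximalIdeal R)^2 → ∀ i, c i ∈ maximalIdeal R) :
    (Ideal.span (Set.range x)).IsPrime := by
  obtain ⟨h, d, hd, -⟩ := aux_qreg x hx hind
  have := aux_domain d _ hd
  exact (Ideal.Quotient.isDomain_iff_prime _).mp this

theorem aux_seq {R : Type u} [CommRing R] [IsRegularLocalRing R] {ι : Type*} [Fintype ι]
    (x : ι → R) (hx : ∀ i, x i ∈ maximalIdeal R)
    (hind : ∀ c : ι → R, ∑ i, c i * x i ∈ (maximalIdeal R)^2 → ∀ i, c i ∈ maximalIdeal R)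
    (L : List ι) (hL : L.Nodup) :
    RingTheory.Sequence.IsRegular R (L.map x) := by
  classical
  refine RingTheory.Sequence.IsRegular.of_isWeaklyRegular_of_mem_maximalIdeal _ ?_ ⟨?_⟩
  · intro r hr
    obtain ⟨i, -, rfl⟩ := List.mem_map.mp hr
    exact hx i
  intro k hk
  have hk' : k < L.length := by simpa using hk
  set s := (L.take k).toFinset with hs
  have hJ : Ideal.ofList ((L.map x).take k) = Ideal.span (Set.range fun i : s => x i) := by
    unfold Ideal.ofList
    congr 1
    ext r
    simp [← List.map_take, hs]
  have hext : ∀ c : s → R, ∑ i : ι, (if h : i ∈ s then c ⟨i, h⟩ else 0) * x i =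
      ∑ i : s, c i * x i := by
    intro c
    rw [← Finset.sum_subset (Finset.subset_univ s), ← Finset.sum_coe_sort]
    · refine Finset.sum_congr rfl fun i _ => ?_
      simp
    · intro i _ hi
      simp [hi]
  have hp := aux_prime (fun i : s => x i) (fun i => hx i) (by
    intro c hc i
    have := hind (fun i => if h : i ∈ s then c ⟨i, h⟩ else 0) (by rw [hext]; exact hc) i
    simpa using this)
  have hnot : L[k] ∉ s := by
    rw [hs, List.mem_toFinset, List.mem_take_iff_getElem]
    rintro ⟨j, hj, he⟩
    have := (List.Nodup.getElem_inj_iff hL).mp he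
    omega
  have hni : x L[k] ∉ Ideal.span (Set.range fun i : s => x i) := by
    intro hmem
    obtain ⟨c, hc⟩ := (Submodule.mem_span_range_iff_exists_fun R).mp hmem
    have h1 := hind (fun i => (if i = L[k] then 1 else 0) - (if h : i ∈ s then c ⟨i, h⟩ else 0)) (by
      simp only [sub_mul, Finset.sum_sub_distrib]
      rw [hext]
      simp only [smul_eq_mul] at hc
      rw [hc]
      simp) L[k]
    simp [hnot] at h1
  rw [hJ, List.getElem_map]
  rw [isSMulRegular_quotient_iff_mem_of_smul_mem]
  intro y hy
  have h2 : x L[k] * y ∈ Ideal.span (Set.range fun i : s => x i) := by simpa using hy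
  simpa using (hp.mem_or_mem h2).resolve_left hni

theorem aux_hind {K A F : Type*} [CommRing K] [CommRing A] [Algebra K A] [Field F] (p : Ideal A)
    [p.IsPrime] (φ : A →+* F) (hφ : ∀ a, φ a = 0 ↔ a ∈ p) {ι κ : Type*} [Fintype ι]
    (d : κ → Derivation K A A) (x : ι → A) (hx : ∀ i, x i ∈ p)
    (hli : LinearIndependent F (fun i k => φ (d k (x i))))
    (c : ι → Localization.AtPrime p)
    (hc : ∑ i, c i * algebraMap A (Localization.AtPrime p) (x i) ∈
      (maximalIdeal (Localization.AtPrime p))^2) (i : ι) :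
    c i ∈ maximalIdeal (Localization.AtPrime p) := by
  obtain ⟨b, hb⟩ := IsLocalization.exist_integer_multiples_of_finite p.primeCompl c
  choose a ha using hb
  have hbu := IsLocalization.map_units (Localization.AtPrime p) b
  have h1 : algebraMap A (Localization.AtPrime p) (∑ i, a i * x i) ∈
      Ideal.map (algebraMap A (Localization.AtPrime p)) (p ^ 2) := by
    rw [Ideal.map_pow, Localization.AtPrime.map_eq_maximalIdeal]
    have := Ideal.mul_mem_left _ (algebraMap A (Localization.AtPrime p) b) hc
    convert this using 1
    rw [map_sum, Finset.mul_sum]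
    refine Finset.sum_congr rfl fun i _ => ?_
    rw [map_mul, ha, Algebra.smul_def, mul_assoc]
  rw [IsLocalization.algebraMap_mem_map_algebraMap_iff p.primeCompl] at h1
  obtain ⟨t, ht, h1⟩ := h1
  have hd : ∀ k, ∀ z ∈ p ^ 2, φ (d k z) = 0 := by
    intro k z hz
    rw [pow_two] at hz
    refine Submodule.mul_induction_on hz ?_ ?_
    · intro u hu w hw
      rw [Derivation.leibniz, map_add, smul_eq_mul, smul_eq_mul, map_mul, map_mul,
        (hφ u).mpr hu, (hφ w).mpr hw]
      simp
    · intro u w hu hw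
      rw [map_add, map_add, hu, hw, add_zero]
  have hsum : ∑ i, φ (a i) • (fun k => φ (d k (x i))) = 0 := by
    funext k
    have h2 := hd k _ h1
    have hz : φ (∑ i, a i * x i) = 0 :=
      (hφ _).mpr (Ideal.sum_mem _ fun i _ => Ideal.mul_mem_left _ _ (hx i))
    rw [Derivation.leibniz, map_add, smul_eq_mul, smul_eq_mul, map_mul, map_mul, hz, zero_mul,
      add_zero] at h2
    have h3 := (mul_eq_zero.mp h2).resolve_left (fun h => ht ((hφ t).mp h))
    rw [map_sum, map_sum] at h3
    simp only [Finset.sum_apply, Pi.smul_apply, smul_eq_mul, Pi.zero_apply]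
    rw [← h3]
    refine Finset.sum_congr rfl fun i _ => ?_
    rw [Derivation.leibniz, map_add, smul_eq_mul, smul_eq_mul, map_mul, map_mul,
      (hφ _).mpr (hx i), zero_mul, add_zero]
  have h4 := (Fintype.linearIndependent_iff.mp hli) _ hsum i
  have h5 : algebraMap A (Localization.AtPrime p) (a i) ∈ maximalIdeal (Localization.AtPrime p) :=
    (IsLocalization.AtPrime.to_map_mem_maximal_iff _ p _).mpr ((hφ _).mp h4)
  rw [ha, Algebra.smul_def] at h5
  exact (Ideal.unit_mul_mem_iff_mem _ hbu).mp h5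

end

end DAEaux

open DAEaux

namespace DAE

open MvPolynomial

theorem aux_trunc_incl (K : Type) [Field K] (n i : ℕ) (a : AP K n i) :
    truncA K n i (inclA K n i a) = a := by
  have : (truncA K n i).comp (inclA K n i) = RingHom.id _ := by
    ext p
    · simp [truncA, inclA]
    · have : (p.2 : ℕ) ≤ i := by omega
      simp [truncA, inclA, this]
  exact congrArg (fun g => g a) this

theorem aux_D_range {K : Type} [Field K] {n : ℕ} {δ : K → K} {D : DP K n → DP K n}
    (hD : IsTotalDeriv K n δ D) (j : ℕ) (a : AP K n j) :
    D (inclA K n j a) ∈ (inclA K n (j + 1)).range := by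
  have hmono : ∀ b : AP K n j, inclA K n j b ∈ (inclA K n (j + 1)).range := fun b =>
    ⟨renAA K n (Nat.le_succ j) b, congrArg (fun g => g b) (inclA_comp_renAA K n (Nat.le_succ j))⟩
  induction a using MvPolynomial.induction_on with
  | C c =>
    refine ⟨C (δ c), ?_⟩
    simp [inclA, hD.map_C]
  | add p q hp hq =>
    rw [map_add, hD.map_add]
    exact add_mem hp hq
  | mul_X p v hp =>
    rw [map_mul, hD.leibniz]
    refine add_mem (mul_mem (hmono p) ?_) (mul_mem (hmono _) hp)
    refine ⟨X (v.1, ⟨v.2 + 1, by omega⟩), ?_⟩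
    simp [inclA, hD.map_X]

theorem aux_iter_range {K : Type} [Field K] {n : ℕ} {δ : K → K} {D : DP K n → DP K n}
    (hD : IsTotalDeriv K n δ D) (e : ℕ) (f : DP K n) (hf : f ∈ (inclA K n e).range) (s : ℕ) :
    ∀ m, m = e + s → D^[s] f ∈ (inclA K n m).range := by
  induction s with
  | zero => rintro m rfl; exact hf
  | succ s ih =>
    rintro m rfl
    obtain ⟨a, ha⟩ := ih _ rfl
    rw [Function.iterate_succ_apply', ← ha]
    exact aux_D_range hD (e + s) a

theorem aux_base_range {K : Type} [Field K] {n : ℕ} (e : ℕ) (f : DP K n)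
    (hf : ∀ j, ordIn f j ≤ e) : f ∈ (inclA K n e).range := by
  have hv : (f.vars : Set (Fin n × ℕ)) ⊆
      Set.range (fun v : Fin n × Fin (e + 1) => ((v.1, (v.2 : ℕ)) : Fin n × ℕ)) := by
    intro v hv
    have h1 : v.2 ≤ ordIn f v.1 :=
      Finset.le_sup (f := fun v : Fin n × ℕ => v.2) (by simpa using hv)
    have h2 := h1.trans (hf v.1)
    exact ⟨(v.1, ⟨v.2, by omega⟩), rfl⟩
  obtain ⟨q, hq⟩ := MvPolynomial.exists_rename_eq_of_vars_subset_range f _ (by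
    rintro ⟨a, b⟩ ⟨c, d⟩ h
    simp only [Prod.mk.injEq] at h
    ext <;> simp [h]) hv
  exact ⟨q, hq⟩

/-- If the system `(Σ)` given by `f_1,…,f_r` is quasi-regular at a
minimal prime differential ideal `𝔓`, then for every `i ≥ 1` the total derivatives
`f_1^{[i-1]},…,f_r^{[i-1]}` form a regular sequence in the local ring `B_{i-1+e}` and
the ideal they generate there is prime. -/
theorem regularSequence_and_prime_of_quasiRegular
    {K : Type} [Field K] [CharZero K] {n r : ℕ} (hrn : r ≤ n)
    (δ : K → K) (hδ : IsDeriv K δ)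
    (D : DP K n → DP K n) (hD : IsTotalDeriv K n δ D)
    (f : Fin r → DP K n)
    (e : ℕ) (he : e = Finset.univ.sup fun p : Fin r × Fin n => ordIn (f p.1) p.2)
    (he1 : 1 ≤ e)
    (𝔓 : Ideal (DP K n)) [𝔓.IsPrime]
    (hmin : IsMinimalPrimeDiff D f 𝔓)
    (hqr : IsQuasiRegularAt D f 𝔓 e)
    (i : ℕ) (hi : 1 ≤ i) :
    RingTheory.Sequence.IsRegular (BL K n (i - 1 + e) 𝔓)
      ((List.finRange r).flatMap fun t =>
        (List.range i).map fun s => bElem 𝔓 (i - 1 + e) (D^[s] (f t))) ∧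
    (Ideal.span {x : BL K n (i - 1 + e) 𝔓 | ∃ t : Fin r, ∃ s < i,
        x = bElem 𝔓 (i - 1 + e) (D^[s] (f t))}).IsPrime := by
  obtain ⟨-, hdiff, hfP, -⟩ := hmin
  have hincl : ∀ (t : Fin r) (s : ℕ), s < i →
      inclA K n (i - 1 + e) (truncA K n (i - 1 + e) (D^[s] (f t))) = D^[s] (f t) := by
    intro t s hs
    obtain ⟨a, ha⟩ := aux_iter_range hD e (f t) (aux_base_range e (f t) (fun j => by
      rw [he]
      exact Finset.le_sup (f := fun p : Fin r × Fin n => ordIn (f p.1) p.2)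
        (Finset.mem_univ (t, j)))) s (s + e) (by omega)
    have hle : s + e ≤ i - 1 + e := by omega
    have h2 : inclA K n (i - 1 + e) (renAA K n hle a) = D^[s] (f t) := by
      rw [← ha]
      exact congrArg (fun g => g a) (inclA_comp_renAA K n hle)
    rw [← h2, aux_trunc_incl]
  have hDP : ∀ (t : Fin r) (s : ℕ), D^[s] (f t) ∈ 𝔓 := by
    intro t s
    induction s with
    | zero => exact hfP t
    | succ s ih => rw [Function.iterate_succ_apply']; exact hdiff _ ih
  let xA : Fin r × Fin i → AP K n (i - 1 + e) :=
    fun p => truncA K n (i - 1 + e) (D^[(p.2 : ℕ)] (f p.1))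
  have hxA : ∀ p, xA p ∈ Pc (i - 1 + e) 𝔓 := by
    intro p
    change inclA K n (i - 1 + e) (xA p) ∈ 𝔓
    rw [hincl _ _ p.2.2]
    exact hDP _ _
  let x : Fin r × Fin i → BL K n (i - 1 + e) 𝔓 :=
    fun p => bElem 𝔓 (i - 1 + e) (D^[(p.2 : ℕ)] (f p.1))
  have hx : ∀ p, x p ∈ IsLocalRing.maximalIdeal (BL K n (i - 1 + e) 𝔓) := fun p =>
    (IsLocalization.AtPrime.to_map_mem_maximal_iff _ (Pc (i - 1 + e) 𝔓) _).mpr (hxA p)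
  let φ : AP K n (i - 1 + e) →+* KK K n 𝔓 := (toKK 𝔓).comp (inclA K n (i - 1 + e))
  have hφ : ∀ a, φ a = 0 ↔ a ∈ Pc (i - 1 + e) 𝔓 := by
    intro a
    change algebraMap (DP K n ⧸ 𝔓) (KK K n 𝔓)
      (Ideal.Quotient.mk 𝔓 (inclA K n (i - 1 + e) a)) = 0 ↔ inclA K n (i - 1 + e) a ∈ 𝔓
    rw [FaithfulSMul.algebraMap_eq_zero_iff, Ideal.Quotient.eq_zero_iff_mem]
  let σ : Fin n × Fin (i + e) → Fin n × Fin (i - 1 + e + 1) := fun q => (q.1, ⟨q.2, by omega⟩)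
  have hinj : Function.Injective
      (fun v : Fin n × Fin (i - 1 + e + 1) => ((v.1, (v.2 : ℕ)) : Fin n × ℕ)) := by
    rintro ⟨a, b⟩ ⟨c, d⟩ h
    simp only [Prod.mk.injEq] at h
    ext <;> simp [h]
  have hli : LinearIndependent (KK K n 𝔓)
      (fun (p : Fin r × Fin i) (q : Fin n × Fin (i + e)) => φ (pderiv (σ q) (xA p))) := by
    have h1 : (fun (p : Fin r × Fin i) (q : Fin n × Fin (i + e)) => φ (pderiv (σ q) (xA p))) =
        (qrJac D f 𝔓 e i).row := by
      funext p q
      change toKK 𝔓 (rename _ (pderiv (σ q) (xA p))) =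
        toKK 𝔓 (pderiv (q.1, (q.2 : ℕ)) (D^[(p.2 : ℕ)] (f p.1)))
      rw [← pderiv_rename hinj]
      congr 2
      exact hincl _ _ p.2.2
    rw [h1, linearIndependent_iff_card_eq_finrank_span, Set.finrank,
      ← Matrix.rank_eq_finrank_span_row, hqr i hi]
    simp
  have hind := aux_hind (Pc (i - 1 + e) 𝔓) φ hφ (fun q => pderiv (R := K) (σ q)) xA hxA hli
  have hreg : IsRegularLocalRing (BL K n (i - 1 + e) 𝔓) := inferInstance
  constructor
  · have := aux_seq x hx hind ((List.finRange r).product (List.finRange i))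
      ((List.nodup_finRange r).product (List.nodup_finRange i))
    have hl : ((List.finRange r).flatMap fun t =>
        (List.range i).map fun s => bElem 𝔓 (i - 1 + e) (D^[s] (f t))) =
        List.map x ((List.finRange r).product (List.finRange i)) := by
      change _ = List.map x ((List.finRange r).flatMap fun t =>
        (List.finRange i).map (Prod.mk t))
      rw [List.map_flatMap]
      congr 1
      funext t
      rw [List.map_map, ← List.map_coe_finRange_eq_range, List.map_map]
      rfl
    rw [hl]
    exact this
  · have := aux_prime x hx hind
    have hl : {x : BL K n (i - 1 + e) 𝔓 | ∃ t : Fin r, ∃ s < i,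
        x = bElem 𝔓 (i - 1 + e) (D^[s] (f t))} = Set.range x := by
      refine Set.ext fun y => ⟨?_, ?_⟩
      · rintro ⟨t, s, hs, rfl⟩
        exact ⟨(t, ⟨s, hs⟩), rfl⟩
      · rintro ⟨p, rfl⟩
        exact ⟨p.1, p.2, p.2.2, rfl⟩
    rw [hl]
    exact this

end DAE
end
end

section
/- Let the DAE system (Σ) given by f_1,…,f_r be quasi-regular at a minimal prime differential ideal 𝔓 containing f_1,…,f_r. Then in the localized ring K{X}_𝔓, the polynomials f_1,…,f_r generate, as a differential ideal, the maximal ideal 𝔓·K{X}_𝔓; i.e. the differential ideal [f_1,…,f_r]·K{X}_𝔓 equals 𝔓·K{X}_𝔓. -/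
set_option synthInstance.maxHeartbeats 1000000
set_option maxHeartbeats 4000000

noncomputable section

namespace DAE

open MvPolynomial


theorem aux_reduced_of_etale (B S : Type*) [CommRing B] [IsDomain B] [CommRing S] [Algebra B S]
    [Algebra.Etale B S] : IsReduced S := by
  have : IsReduced (TensorProduct B (FractionRing B) S) :=
    Algebra.FormallyUnramified.isReduced_of_field (FractionRing B) _
  have hinj : Function.Injective
      (Algebra.TensorProduct.includeRight : S →ₐ[B] TensorProduct B (FractionRing B) S) :=
    Algebra.TensorProduct.includeRight_injective (IsFractionRing.injective B (FractionRing B))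
  exact isReduced_of_injective _ hinj

theorem aux_minor {F : Type*} [Field F] {ι κ : Type*} [Fintype ι] [DecidableEq ι] [Fintype κ]
    (A : Matrix ι κ F) (h : A.rank = Fintype.card ι) :
    ∃ c : ι → κ, Function.Injective c ∧ (A.submatrix id c).det ≠ 0 := by
  classical
  obtain ⟨τ, a, ha, hs, hli⟩ := exists_linearIndependent' F A.col
  have : Finite τ := Finite.of_injective a ha
  have := Fintype.ofFinite τ
  have hc : Fintype.card ι = Fintype.card τ := by
    rw [← h, Matrix.rank_eq_finrank_span_cols, ← hs, finrank_span_eq_card hli]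
  let E := Fintype.equivOfCardEq hc
  refine ⟨a ∘ E, ha.comp E.injective, ?_⟩
  have : LinearIndependent F (A.submatrix id (a ∘ E)).col := hli.comp E E.injective
  rw [Matrix.linearIndependent_cols_iff_isUnit, Matrix.isUnit_iff_isUnit_det] at this
  exact this.ne_zero

theorem aux_L2 {B : Type*} [CommRing B] [IsDomain B] {ι : Type*} [Fintype ι] [DecidableEq ι]
    (F : ι → MvPolynomial ι B) (g : MvPolynomial ι B) (k : ℕ)
    (hg : g ^ k ∈ Ideal.span (Set.range F)) :
    ∃ N : ℕ, (Matrix.of fun i j => pderiv j (F i)).det ^ N * g ∈ Ideal.span (Set.range F) := by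
  classical
  let Q := MvPolynomial ι B ⧸ Ideal.span (Set.range F)
  let P0 : Algebra.PreSubmersivePresentation B Q ι ι :=
    { Algebra.Presentation.naive (v := F) with
      map := id
      map_inj := Function.injective_id }
  have hj : P0.jacobian = Ideal.Quotient.mk _ (Matrix.of fun i j => pderiv j (F i)).det := by
    rw [P0.jacobian_eq_jacobiMatrix_det, ← Matrix.det_transpose]
    have : P0.jacobiMatrix.transpose = (Matrix.of fun i j => pderiv j (F i)) := by
      ext1 i j
      simp only [Matrix.transpose_apply, P0.jacobiMatrix_apply]
      rfl
    rw [this]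
    rfl
  let T := Localization.Away P0.jacobian
  let Loc : Algebra.PreSubmersivePresentation Q T Unit Unit :=
    Algebra.PreSubmersivePresentation.localizationAway T P0.jacobian
  have hu : IsUnit (algebraMap Q T P0.jacobian) := IsLocalization.Away.algebraMap_isUnit _
  let P : Algebra.SubmersivePresentation B T (Unit ⊕ ι) (Unit ⊕ ι) :=
    { Loc.comp P0 with
      jacobian_isUnit := by
        rw [Algebra.PreSubmersivePresentation.comp_jacobian_eq_jacobian_smul_jacobian]
        rw [Algebra.smul_def]
        refine IsUnit.mul hu ?_
        rw [Algebra.PreSubmersivePresentation.localizationAway_jacobian]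
        exact hu }
  have : Algebra.IsStandardSmoothOfRelativeDimension 0 B T :=
    P.isStandardSmoothOfRelativeDimension (by simp [Algebra.Presentation.dimension])
  have : Algebra.Etale B T := Algebra.Etale.iff_isStandardSmoothOfRelativeDimension_zero.2 this
  have : IsReduced T := aux_reduced_of_etale B T
  have h1 : algebraMap Q T (Ideal.Quotient.mk _ g) = 0 := by
    apply IsReduced.eq_zero (R := T)
    refine ⟨k, ?_⟩
    rw [← map_pow, ← map_pow, Ideal.Quotient.eq_zero_iff_mem.2 hg, map_zero]
  rw [IsLocalization.map_eq_zero_iff (Submonoid.powers P0.jacobian)] at h1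
  obtain ⟨⟨_, N, rfl⟩, hm⟩ := h1
  refine ⟨N, ?_⟩
  rw [← Ideal.Quotient.eq_zero_iff_mem, map_mul, map_pow, ← hj]
  exact hm

theorem aux_equiv (K : Type*) [Field K] {σ ι : Type*} (c : ι → σ) (hc : Function.Injective c) :
    ∃ Φ : MvPolynomial σ K ≃+* MvPolynomial ι (MvPolynomial {x : σ // x ∉ Set.range c} K),
      ∀ j p, pderiv j (Φ p) = Φ (pderiv (c j) p) := by
  classical
  let κ := {x : σ // x ∉ Set.range c}
  let E : ι ⊕ κ ≃ σ :=
    ((Equiv.ofInjective c hc).sumCongr (Equiv.refl _)).trans (Equiv.Set.sumCompl (Set.range c))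
  have hE : ∀ j, E.symm (c j) = Sum.inl j := by
    intro j
    rw [Equiv.symm_apply_eq]
    rfl
  refine ⟨(renameEquiv K E.symm).toRingEquiv.trans (sumRingEquiv K ι κ), ?_⟩
  intro j p
  rw [RingEquiv.trans_apply, RingEquiv.trans_apply, pderiv_sumRingEquiv]
  congr 1
  have := pderiv_rename E.symm.injective (c j) p
  rw [hE] at this
  exact this

theorem aux_L3 {K : Type*} [Field K] {σ ι : Type*} [Fintype ι] [DecidableEq ι]
    (c : ι → σ) (hc : Function.Injective c)
    (F : ι → MvPolynomial σ K) (g : MvPolynomial σ K) (k : ℕ)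
    (hg : g ^ k ∈ Ideal.span (Set.range F)) :
    ∃ N : ℕ, (Matrix.of fun i j => pderiv (c j) (F i)).det ^ N * g ∈ Ideal.span (Set.range F) := by
  obtain ⟨Φ, hΦ⟩ := aux_equiv K c hc
  have hmap : (Ideal.span (Set.range F)).map Φ = Ideal.span (Set.range fun i => Φ (F i)) := by
    rw [Ideal.map_span, ← Set.range_comp]; rfl
  obtain ⟨N, hN⟩ := aux_L2 (fun i => Φ (F i)) (Φ g) k (by
    rw [← hmap, ← map_pow]; exact Ideal.mem_map_of_mem _ hg)
  refine ⟨N, ?_⟩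
  have hdet : (Matrix.of fun i j => pderiv j (Φ (F i))).det
      = Φ (Matrix.of fun i j => pderiv (c j) (F i)).det := by
    rw [RingEquiv.map_det]
    congr 1
    ext1 i j
    exact hΦ _ _
  rw [hdet, ← map_pow, ← map_mul, ← hmap, Ideal.mem_map_of_equiv Φ] at hN
  obtain ⟨x, hx, hx'⟩ := hN
  rwa [← Φ.injective hx']

theorem aux_iter_add {K : Type} [Field K] {n : ℕ} (D : DP K n → DP K n) (hadd : ∀ f g, D (f + g) = D f + D g) (m : ℕ)
    (a b : DP K n) : D^[m] (a + b) = D^[m] a + D^[m] b := by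
  induction m generalizing a b with
  | zero => rfl
  | succ m ih => rw [Function.iterate_succ_apply, hadd, ih]; rfl

theorem aux_leibniz {K : Type} [Field K] {n : ℕ} (D : DP K n → DP K n) (hadd : ∀ f g, D (f + g) = D f + D g)
    (hmul : ∀ f g, D (f * g) = f * D g + g * D f) (m : ℕ) (a b : DP K n) :
    D^[m] (a * b) = ∑ p ∈ Finset.HasAntidiagonal.antidiagonal m, m.choose p.1 • (D^[p.1] a * D^[p.2] b) := by
  let D' : DP K n →+ DP K n := AddMonoidHom.mk' D hadd
  have hD' : ∀ x, D x = D' x := fun _ => rfl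
  induction m with
  | zero => simp
  | succ m ih =>
    rw [Finset.sum_antidiagonal_choose_succ_nsmul (fun i j => D^[i] a * D^[j] b) m,
      Function.iterate_succ_apply', ih, hD', map_sum, ← Finset.sum_add_distrib]
    refine Finset.sum_congr rfl fun p hp => ?_
    have hs : m.choose p.2 = m.choose p.1 := by
      rw [← Nat.choose_symm_of_eq_add (Finset.HasAntidiagonal.mem_antidiagonal.1 hp).symm]
    rw [map_nsmul, ← hD', hmul, hs, ← nsmul_add, Function.iterate_succ_apply',
      Function.iterate_succ_apply']
    congr 1
    ring

theorem aux_ritt {K : Type} [Field K] {n : ℕ} [CharZero K] (D : DP K n → DP K n) (hadd : ∀ f g, D (f + g) = D f + D g)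
    (hmul : ∀ f g, D (f * g) = f * D g + g * D f) (I Q : Ideal (DP K n))
    (hI : IsDiffIdeal D I) (hQ : Q ∈ I.minimalPrimes) : IsDiffIdeal D Q := by
  classical
  have hQp : Q.IsPrime := hQ.1.1
  let Z : Ideal (DP K n) :=
    { carrier := {x | ∀ m, D^[m] x ∈ Q}
      add_mem' := fun {a b} ha hb m => by
        rw [aux_iter_add D hadd]; exact Q.add_mem (ha m) (hb m)
      zero_mem' := fun m => by
        have : D^[m] (0 : DP K n) = 0 := by
          have := aux_iter_add D hadd m 0 0
          simpa using this
        rw [this]; exact Q.zero_mem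
      smul_mem' := fun c x hx m => by
        rw [smul_eq_mul, aux_leibniz D hadd hmul]
        exact Q.sum_mem fun p _ => Q.smul_of_tower_mem _ (Q.mul_mem_left _ (hx _)) }
  have hZQ : Z ≤ Q := fun x hx => hx 0
  have hIZ : I ≤ Z := fun x hx m => by
    apply hQ.1.2
    induction m with
    | zero => exact hx
    | succ m ih => rw [Function.iterate_succ_apply']; exact hI _ ih
  have hZp : Z.IsPrime := by
    refine ⟨fun h => hQp.ne_top (top_le_iff.1 (h ▸ hZQ)), ?_⟩
    intro a b hab
    by_contra hcon
    push Not at hcon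
    obtain ⟨ha, hb⟩ := hcon
    have ha' : ∃ i, D^[i] a ∉ Q := by
      by_contra h; push Not at h; exact ha h
    have hb' : ∃ i, D^[i] b ∉ Q := by
      by_contra h; push Not at h; exact hb h
    obtain ⟨hi, hi'⟩ := And.intro (Nat.find_spec ha') (fun k => Nat.find_min ha' (m := k))
    obtain ⟨hj, hj'⟩ := And.intro (Nat.find_spec hb') (fun k => Nat.find_min hb' (m := k))
    set i := Nat.find ha'
    set j := Nat.find hb'
    have h := hab (i + j)
    rw [aux_leibniz D hadd hmul, ← Finset.add_sum_erase _ _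
      (show (i, j) ∈ Finset.HasAntidiagonal.antidiagonal (i + j) by simp)] at h
    have h2 : ∑ p ∈ (Finset.HasAntidiagonal.antidiagonal (i + j)).erase (i, j),
        (i + j).choose p.1 • (D^[p.1] a * D^[p.2] b) ∈ Q := by
      refine Q.sum_mem fun p hp => Q.smul_of_tower_mem _ ?_
      rw [Finset.mem_erase, Finset.HasAntidiagonal.mem_antidiagonal] at hp
      rcases lt_trichotomy p.1 i with h3 | h3 | h3
      · exact Q.mul_mem_right _ (not_not.1 (hi' _ h3))
      · exact absurd (Prod.ext h3 (by simp only; omega)) hp.1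
      · exact Q.mul_mem_left _ (not_not.1 (hj' _ (by omega)))
    have h3 := (Q.add_mem_iff_left h2).1 h
    simp only [nsmul_eq_mul] at h3
    rcases hQp.mem_or_mem h3 with h4 | h4
    · have h0 : (((i + j).choose i : ℕ) : K) ≠ 0 :=
        Nat.cast_ne_zero.2 (Nat.choose_pos (Nat.le_add_right _ _)).ne'
      apply hQp.ne_top
      refine Q.eq_top_of_isUnit_mem h4 ?_
      have := (isUnit_iff_ne_zero.2 h0).map (C : K →+* DP K n)
      rwa [map_natCast] at this
    · rcases hQp.mem_or_mem h4 with h5 | h5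
      · exact hi h5
      · exact hj h5
  have hQZ : Q ≤ Z := hQ.2 ⟨hZp, hIZ⟩ hZQ
  intro g hg
  exact hQZ hg 1

theorem aux_gen {K : Type} [Field K] {n : ℕ} (D : DP K n → DP K n) (hadd : ∀ f g, D (f + g) = D f + D g)
    (hmul : ∀ f g, D (f * g) = f * D g + g * D f) {r : ℕ} (f : Fin r → DP K n) :
    IsDiffIdeal D (diffIdealGen D f) ∧ (∀ t, f t ∈ diffIdealGen D f) ∧
    ∀ g ∈ diffIdealGen D f, ∃ i : ℕ, 1 ≤ i ∧
      g ∈ Ideal.span (Set.range fun p : Fin r × Fin i => D^[(p.2 : ℕ)] (f p.1)) := by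
  refine ⟨fun g hg => ?_, fun t => ?_, ?_⟩
  · rw [diffIdealGen, Ideal.mem_sInf] at hg ⊢
    intro I hI
    exact hI.2 _ (hg hI)
  · rw [diffIdealGen, Ideal.mem_sInf]
    intro I hI
    exact hI.1 t
  · let J : ℕ → Ideal (DP K n) := fun i =>
      Ideal.span (Set.range fun p : Fin r × Fin (i + 1) => D^[(p.2 : ℕ)] (f p.1))
    have hJ : Monotone J := by
      intro i j hij
      refine Ideal.span_mono ?_
      rintro _ ⟨p, rfl⟩
      exact ⟨(p.1, ⟨p.2, by omega⟩), rfl⟩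
    have key : diffIdealGen D f ≤ ⨆ i, J i := by
      refine sInf_le ⟨fun t => ?_, fun g hg => ?_⟩
      · exact le_iSup J 0 (Ideal.subset_span ⟨(t, 0), rfl⟩)
      · obtain ⟨i, hi⟩ := (Submodule.mem_iSup_of_directed J hJ.directed_le).1 hg
        refine le_iSup J (i + 1) ?_
        have hi2 : g ∈ J (i + 1) := hJ (Nat.le_succ i) hi
        clear hi2
        have h0 : D 0 = 0 := by simpa using hadd 0 0
        change g ∈ Ideal.span _ at hi
        induction hi using Submodule.span_induction with
        | mem x hx =>
          obtain ⟨p, rfl⟩ := hx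
          refine Ideal.subset_span ⟨(p.1, ⟨p.2 + 1, by omega⟩), ?_⟩
          exact Function.iterate_succ_apply' _ _ _
        | zero => rw [h0]; exact Ideal.zero_mem _
        | add x y hx hy ihx ihy =>
          rw [hadd]
          exact Ideal.add_mem _ (ihx (le_iSup J i hx)) (ihy (le_iSup J i hy))
        | smul a x hx ih =>
          rw [smul_eq_mul, hmul]
          exact Ideal.add_mem _ (Ideal.mul_mem_left _ _ (ih (le_iSup J i hx)))
            (Ideal.mul_mem_right _ _ (hJ (Nat.le_succ i) hx))
    intro g hg
    obtain ⟨i, hi⟩ := (Submodule.mem_iSup_of_directed J hJ.directed_le).1 (key hg)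
    exact ⟨i + 1, by omega, hi⟩

theorem aux_span_le {K : Type} [Field K] {n : ℕ} (D : DP K n → DP K n) {r : ℕ} (f : Fin r → DP K n) (i : ℕ)
    (I : Ideal (DP K n)) (hI : IsDiffIdeal D I) (hf : ∀ t, f t ∈ I) :
    Ideal.span (Set.range fun p : Fin r × Fin i => D^[(p.2 : ℕ)] (f p.1)) ≤ I := by
  rw [Ideal.span_le]
  rintro _ ⟨p, rfl⟩
  have : ∀ m, D^[m] (f p.1) ∈ I := by
    intro m
    induction m with
    | zero => exact hf _
    | succ m ih => rw [Function.iterate_succ_apply']; exact hI _ ih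
  exact this _

/-- If `(Σ)` is quasi-regular at the minimal prime differential
ideal `𝔓`, then in `K{X}_𝔓` the differential ideal generated by `f_1,…,f_r`
equals the maximal ideal `𝔓·K{X}_𝔓`. -/
theorem diffIdeal_localization_eq_maximalIdeal
    {K : Type} [Field K] [CharZero K] {n r : ℕ} (hrn : r ≤ n)
    (δ : K → K) (hδ : IsDeriv K δ)
    (D : DP K n → DP K n) (hD : IsTotalDeriv K n δ D)
    (f : Fin r → DP K n)
    (e : ℕ) (he : e = Finset.univ.sup fun p : Fin r × Fin n => ordIn (f p.1) p.2)
    (he1 : 1 ≤ e)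
    (𝔓 : Ideal (DP K n)) [𝔓.IsPrime]
    (hmin : IsMinimalPrimeDiff D f 𝔓)
    (hqr : IsQuasiRegularAt D f 𝔓 e) :
    Ideal.map (algebraMap (DP K n) (Localization.AtPrime 𝔓)) (diffIdealGen D f)
      = bigDelta 𝔓 := by
  have hadd := hD.map_add
  have hmul := hD.leibniz
  obtain ⟨hP, hPD, hfP, hPmin⟩ := hmin
  obtain ⟨hID, hfI, hIfin⟩ := aux_gen D hadd hmul f
  have hIP : diffIdealGen D f ≤ 𝔓 := sInf_le ⟨hfP, hPD⟩
  have hPI : 𝔓 ∈ (diffIdealGen D f).minimalPrimes := by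
    obtain ⟨Q, hQ, hQP⟩ := Ideal.exists_minimalPrimes_le hIP
    have hQD := aux_ritt D hadd hmul _ Q hID hQ
    have : Q = 𝔓 := hPmin Q hQ.1.1 hQD (fun t => hQ.1.2 (hfI t)) hQP
    exact this ▸ hQ
  refine le_antisymm (Ideal.map_mono hIP) ?_
  rw [bigDelta, Ideal.map_le_iff_le_comap]
  intro g hg
  rw [Ideal.mem_comap]
  have hrad : algebraMap (DP K n) (Localization.AtPrime 𝔓) g ∈
      (Ideal.map (algebraMap (DP K n) (Localization.AtPrime 𝔓)) (diffIdealGen D f)).radical := by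
    rw [IsLocalization.AtPrime.radical_map_of_mem_minimalPrimes _ 𝔓 _ hPI]
    exact Ideal.mem_map_of_mem _ hg
  obtain ⟨k, hk⟩ := hrad
  rw [← map_pow, IsLocalization.algebraMap_mem_map_algebraMap_iff 𝔓.primeCompl] at hk
  obtain ⟨s, hs, hsg⟩ := hk
  have hsg' : (s * g) ^ (k + 1) ∈ diffIdealGen D f := by
    have : (s * g) ^ (k + 1) = (s ^ k * g) * (s * g ^ k) := by ring
    rw [this]
    exact Ideal.mul_mem_left _ _ hsg
  obtain ⟨i, hi1, hi⟩ := hIfin _ hsg'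
  obtain ⟨c, hc, hdet⟩ := aux_minor (qrJac D f 𝔓 e i) (by simp [hqr i hi1])
  let c' : Fin r × Fin i → Fin n × ℕ := fun p => ((c p).1, ((c p).2 : ℕ))
  have hc' : Function.Injective c' := by
    intro p q hpq
    apply hc
    simp only [c', Prod.mk.injEq] at hpq
    exact Prod.ext hpq.1 (Fin.ext hpq.2)
  obtain ⟨N, hN⟩ := aux_L3 c' hc' (fun p : Fin r × Fin i => D^[(p.2 : ℕ)] (f p.1)) (s * g) (k + 1) hi
  set h := (Matrix.of fun (p q : Fin r × Fin i) => pderiv (c' q) (D^[(p.2 : ℕ)] (f p.1))).det with hh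
  have hhP : h ∉ 𝔓 := by
    intro hmem
    apply hdet
    have h1 : toKK 𝔓 h = 0 := by
      rw [toKK, RingHom.comp_apply, Ideal.Quotient.eq_zero_iff_mem.2 hmem, map_zero]
    rw [← h1, hh, RingHom.map_det]
    rfl
  rw [IsLocalization.algebraMap_mem_map_algebraMap_iff 𝔓.primeCompl]
  refine ⟨h ^ N * s, ?_, ?_⟩
  · exact 𝔓.primeCompl.mul_mem (𝔓.primeCompl.pow_mem hhP N) hs
  · rw [mul_assoc]
    exact aux_span_le D f i _ hID hfI hN

end DAE
end
end

section
/- Let the DAE system (Σ) given by f_1,…,f_r be quasi-regular at a minimal prime differential ideal 𝔓 containing f_1,…,f_r, and let 𝕂 denote the residual field of 𝔓 (the fraction field of K{X}/𝔓). Then the differential transcendence degree of 𝕂 over K equals n − r. -/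
set_option synthInstance.maxHeartbeats 1000000
set_option maxHeartbeats 4000000

noncomputable section

namespace DAEaux

open MvPolynomial

set_option linter.unusedSectionVars false

section grad

variable {K L σ : Type} [Field K] [Field L] [Algebra K L]

/-- the gradient of `g`, evaluated in `L` -/
def grad (τ : MvPolynomial σ K →ₐ[K] L) (g : MvPolynomial σ K) : σ →₀ L :=
  Finsupp.onFinset g.vars (fun v => τ (pderiv v g)) (by
    intro v hv
    by_contra h
    exact hv (by rw [pderiv_eq_zero_of_notMem_vars h, map_zero]))

@[simp] lemma grad_apply (τ : MvPolynomial σ K →ₐ[K] L) (g : MvPolynomial σ K) (v : σ) :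
    grad τ g v = τ (pderiv v g) := rfl

lemma chain (τ : MvPolynomial σ K →ₐ[K] L) {M : Type} [AddCommGroup M] [Module L M]
    (Δ : MvPolynomial σ K → M) (hadd : ∀ p q, Δ (p + q) = Δ p + Δ q) (hC : ∀ a, Δ (C a) = 0)
    (hmul : ∀ p q, Δ (p * q) = τ p • Δ q + τ q • Δ p) (p : MvPolynomial σ K) :
    Δ p = Finsupp.linearCombination L (fun v => Δ (X v)) (grad τ p) := by
  induction p using MvPolynomial.induction_on with
  | C a =>
    rw [hC]
    have : grad τ (C a : MvPolynomial σ K) = 0 := by ext v; simp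
    rw [this, map_zero]
  | add p q hp hq =>
    rw [hadd, hp, hq, ← map_add]
    congr 1
    ext v; simp
  | mul_X p w hp =>
    classical
    rw [hmul, hp]
    have : grad τ (p * X w) = τ p • Finsupp.single w (1:L) + τ (X w) • grad τ p := by
      ext v
      simp [pderiv_X, Finsupp.single_apply, Pi.single_apply, mul_comm]
      split_ifs <;> simp_all
    rw [this, map_add, map_smul, map_smul]
    simp

open PowerSeries in
lemma constCoeff_aeval (τ : MvPolynomial σ K →ₐ[K] L) (x : σ → PowerSeries L)
    (hx : ∀ w, PowerSeries.constantCoeff (x w) = τ (X w)) (p : MvPolynomial σ K) :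
    PowerSeries.constantCoeff (aeval x p) = τ p := by
  induction p using MvPolynomial.induction_on with
  | C a => 
    rw [← MvPolynomial.algebraMap_eq, AlgHom.commutes, AlgHom.commutes]
    simp [PowerSeries.algebraMap_apply]
  | add p q hp hq => simp [hp, hq]
  | mul_X p w hp => simp [hp, hx]

lemma congr_aeval (x y : σ → PowerSeries L) (M : ℕ)
    (h : ∀ w, (PowerSeries.X : PowerSeries L) ^ M ∣ x w - y w) (p : MvPolynomial σ K) :
    (PowerSeries.X : PowerSeries L) ^ M ∣ aeval x p - aeval y p := by
  induction p using MvPolynomial.induction_on with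
  | C a => simp
  | add p q hp hq =>
    simp only [map_add]
    convert dvd_add hp hq using 1
    ring
  | mul_X p w hp =>
    simp only [map_mul, aeval_X]
    have : aeval x p * x w - aeval y p * y w
      = aeval x p * (x w - y w) + (aeval x p - aeval y p) * y w := by ring
    rw [this]
    exact dvd_add (Dvd.dvd.mul_left (h w) _) (Dvd.dvd.mul_right hp _)

lemma coeff_mul_of_dvd (a b : PowerSeries L) (M : ℕ) (h : (PowerSeries.X : PowerSeries L) ^ M ∣ b) :
    PowerSeries.coeff M (a * b) = PowerSeries.constantCoeff a * PowerSeries.coeff M b := by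
  obtain ⟨c, rfl⟩ := h
  have : a * (PowerSeries.X ^ M * c) = PowerSeries.X ^ M * (a * c) := by ring
  rw [this]
  have h1 := PowerSeries.coeff_X_pow_mul (a * c) M 0
  have h2 := PowerSeries.coeff_X_pow_mul c M 0
  rw [zero_add] at h1 h2
  rw [h1, h2]
  simp

lemma first_order (τ : MvPolynomial σ K →ₐ[K] L) (x y : σ → PowerSeries L)
    (hx : ∀ w, PowerSeries.constantCoeff (x w) = τ (X w))
    (hy : ∀ w, PowerSeries.constantCoeff (y w) = τ (X w)) (M : ℕ)
    (h : ∀ w, (PowerSeries.X : PowerSeries L) ^ M ∣ x w - y w) (p : MvPolynomial σ K) :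
    PowerSeries.coeff M (aeval x p - aeval y p) =
      Finsupp.linearCombination L (fun w => PowerSeries.coeff M (x w - y w)) (grad τ p) := by
  have := chain τ (fun p => PowerSeries.coeff M (aeval x p - aeval y p))
    (by intro p q; simp; ring) (by intro a; simp) (by
      intro p q
      have e : aeval x (p * q) - aeval y (p * q)
        = aeval x p * (aeval x q - aeval y q) + aeval y q * (aeval x p - aeval y p) := by
        simp only [map_mul]; ring
      simp only [e, map_add (PowerSeries.coeff M)]
      rw [coeff_mul_of_dvd _ _ _ (congr_aeval x y M h q),
        coeff_mul_of_dvd _ _ _ (congr_aeval x y M h p),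
        constCoeff_aeval τ x hx, constCoeff_aeval τ y hy]
      rfl) p
  simpa using this

lemma exists_functional {R : Type} (g : R → (σ →₀ L)) (hg : LinearIndependent L g) (c : R → L) :
    ∃ v : σ → L, ∀ ρ, Finsupp.linearCombination L v (g ρ) = c ρ := by
  obtain ⟨ℓ, hℓ⟩ := LinearMap.exists_leftInverse_of_injective (Finsupp.linearCombination L g)
    (LinearMap.ker_eq_bot.2 hg)
  let m : (σ →₀ L) →ₗ[L] L := (Finsupp.linearCombination L c).comp ℓ
  refine ⟨fun w => m (Finsupp.single w 1), fun ρ => ?_⟩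
  have h1 : Finsupp.linearCombination L (fun w => m (Finsupp.single w 1)) = m := by
    ext w; simp
  rw [h1]
  have h2 : ℓ (g ρ) = Finsupp.single ρ 1 := by
    have := LinearMap.congr_fun hℓ (Finsupp.single ρ 1)
    simpa using this
  simp [m, h2]

lemma exists_curve (τ : MvPolynomial σ K →ₐ[K] L) {R : Type} (F : R → MvPolynomial σ K)
    (hF : ∀ ρ, τ (F ρ) = 0) (hli : LinearIndependent L fun ρ => grad τ (F ρ))
    (v : σ → L) (hv : ∀ ρ, Finsupp.linearCombination L v (grad τ (F ρ)) = 0) :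
    ∃ x : σ → PowerSeries L, (∀ w, PowerSeries.constantCoeff (x w) = τ (X w)) ∧
      (∀ w, PowerSeries.coeff 1 (x w) = v w) ∧ ∀ ρ, aeval x (F ρ) = 0 := by
  choose u hu using exists_functional _ hli
  let x₀ : σ → PowerSeries L := fun w => PowerSeries.C (τ (X w)) + PowerSeries.monomial 1 (v w)
  let step : ℕ → (σ → PowerSeries L) → σ → PowerSeries L := fun m x w =>
    x w + PowerSeries.monomial (m + 2) (u (fun ρ => - PowerSeries.coeff (m + 2) (aeval x (F ρ))) w)
  let s : ℕ → σ → PowerSeries L := fun m => Nat.rec x₀ step m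
  have s0 : s 0 = x₀ := rfl
  have ss : ∀ m, s (m + 1) = step m (s m) := fun m => rfl
  have hc : ∀ m w, PowerSeries.constantCoeff (s m w) = τ (X w) := by
    intro m w
    induction m with
    | zero => 
      simp only [s0, x₀, map_add, ← PowerSeries.coeff_zero_eq_constantCoeff_apply,
        PowerSeries.coeff_monomial]
      simp
    | succ m ih =>
      rw [ss]
      simp only [step, map_add, ih]
      simp only [← PowerSeries.coeff_zero_eq_constantCoeff_apply, PowerSeries.coeff_monomial]
      simp
  have hd : ∀ m w, (PowerSeries.X : PowerSeries L) ^ (m + 2) ∣ s (m + 1) w - s m w := by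
    intro m w
    rw [PowerSeries.X_pow_dvd_iff]
    intro k hk
    rw [ss]
    simp only [step, add_sub_cancel_left, PowerSeries.coeff_monomial]
    rw [if_neg (by omega)]
  have hd' : ∀ k m w, (PowerSeries.X : PowerSeries L) ^ (m + 2) ∣ s (m + k) w - s m w := by
    intro k m w
    induction k with
    | zero => simp
    | succ k ih =>
      have e : s (m + (k + 1)) w - s m w = (s (m + k + 1) w - s (m + k) w) + (s (m + k) w - s m w) := by
        rw [← add_assoc]; ring
      rw [e]
      exact dvd_add ((pow_dvd_pow _ (by omega)).trans (hd (m + k) w)) ih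
  have inv : ∀ m ρ, (PowerSeries.X : PowerSeries L) ^ (m + 2) ∣ aeval (s m) (F ρ) := by
    intro m
    induction m with
    | zero =>
      intro ρ
      rw [PowerSeries.X_pow_dvd_iff]
      intro k hk
      let z : σ → PowerSeries L := fun w => PowerSeries.C (τ (X w))
      have hz : aeval z (F ρ) = 0 := by
        have : (aeval z : MvPolynomial σ K →ₐ[K] PowerSeries L).toRingHom
          = PowerSeries.C.comp τ.toRingHom := by
          ext a
          · simp [PowerSeries.algebraMap_apply]
          · simp [z]
        have h2 := RingHom.congr_fun this (F ρ)
        simp only [RingHom.comp_apply] at h2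
        exact h2.trans (by simp [hF])
      interval_cases k
      · rw [PowerSeries.coeff_zero_eq_constantCoeff_apply, constCoeff_aeval τ _ (hc 0), hF]
      · have := first_order τ (s 0) z (hc 0) (by intro w; simp [z]) 1 (by
          intro w
          simp only [s0, x₀, z, add_sub_cancel_left]
          rw [PowerSeries.X_pow_dvd_iff]
          intro k hk
          rw [PowerSeries.coeff_monomial, if_neg (by omega)]) (F ρ)
        rw [hz, sub_zero] at this
        rw [this, ← hv ρ]
        congr 2
        ext w
        simp only [s0, x₀, z, add_sub_cancel_left, PowerSeries.coeff_monomial]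
        simp
    | succ m ih =>
      intro ρ
      rw [PowerSeries.X_pow_dvd_iff]
      intro k hk
      have hk' : k < m + 2 ∨ k = m + 2 := by omega
      rcases hk' with hk' | rfl
      · have h1 := congr_aeval (s (m+1)) (s m) (m+2) (hd m) (F ρ)
        have h2 := dvd_add h1 (ih ρ)
        rw [sub_add_cancel, PowerSeries.X_pow_dvd_iff] at h2
        exact h2 k hk'
      · have h1 := first_order τ (s (m+1)) (s m) (hc (m+1)) (hc m) (m+2) (hd m) (F ρ)
        have h2 : (fun w => PowerSeries.coeff (m+2) (s (m+1) w - s m w)) =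
          u (fun ρ => - PowerSeries.coeff (m + 2) (aeval (s m) (F ρ))) := by
          ext w
          rw [ss]
          simp only [step, add_sub_cancel_left, PowerSeries.coeff_monomial]
          simp
        rw [h2, hu, map_sub] at h1
        linear_combination h1
  let x : σ → PowerSeries L := fun w => PowerSeries.mk fun k => PowerSeries.coeff k (s k w)
  have hxs : ∀ m w, (PowerSeries.X : PowerSeries L) ^ (m + 1) ∣ x w - s m w := by
    intro m w
    rw [PowerSeries.X_pow_dvd_iff]
    intro k hk
    obtain ⟨j, rfl⟩ := Nat.exists_eq_add_of_le (Nat.lt_succ_iff.1 hk)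
    have := hd' j k w
    rw [PowerSeries.X_pow_dvd_iff] at this
    have := this k (by omega)
    simp only [x, map_sub, PowerSeries.coeff_mk] at this ⊢
    linear_combination -this
  refine ⟨x, ?_, ?_, ?_⟩
  · intro w
    rw [← hc 0 w]
    simp only [x, ← PowerSeries.coeff_zero_eq_constantCoeff_apply, PowerSeries.coeff_mk]
  · intro w
    have := hd 0 w
    rw [PowerSeries.X_pow_dvd_iff] at this
    have := this 1 (by omega)
    rw [map_sub] at this
    simp only [x, PowerSeries.coeff_mk]
    refine (sub_eq_zero.1 this).trans ?_
    rw [s0]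
    simp only [x₀, map_add, PowerSeries.coeff_monomial, PowerSeries.coeff_C]
    simp
  · intro ρ
    ext m
    have h1 := congr_aeval x (s m) (m+1) (hxs m) (F ρ)
    have h2 := dvd_add h1 ((pow_dvd_pow _ (by omega)).trans (inv m ρ))
    rw [sub_add_cancel, PowerSeries.X_pow_dvd_iff] at h2
    rw [h2 m (by omega)]
    simp

end grad

section star

variable {A : Type} [CommRing A]

lemma iter_leibniz (D : A →+ A) (hD : ∀ a b, D (a * b) = a * D b + b * D a) (N : ℕ) (a b : A) :
    D^[N] (a * b) = ∑ ij ∈ Finset.HasAntidiagonal.antidiagonal N, N.choose ij.1 • (D^[ij.1] a * D^[ij.2] b) := by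
  induction N with
  | zero => simp
  | succ n ih =>
    rw [Finset.sum_antidiagonal_choose_succ_nsmul (M := A) (fun i j => D^[i] a * D^[j] b) n]
    simp only [Function.iterate_succ_apply', ih, map_sum, map_nsmul, hD, smul_add,
      Finset.sum_add_distrib, add_right_inj]
    refine Finset.sum_congr rfl fun ⟨i, j⟩ hij ↦ ?_
    rw [n.choose_symm_of_eq_add (Finset.HasAntidiagonal.mem_antidiagonal.1 hij).symm, mul_comm]

lemma iter_add (D : A →+ A) (N : ℕ) (a b : A) : D^[N] (a + b) = D^[N] a + D^[N] b := by
  induction N generalizing a b with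
  | zero => rfl
  | succ n ih => simp [Function.iterate_succ_apply, ih]

/-- the largest differential ideal in `Q` -/
def starI (D : A →+ A) (hD : ∀ a b, D (a * b) = a * D b + b * D a) (Q : Ideal A) : Ideal A where
  carrier := {g | ∀ k, D^[k] g ∈ Q}
  zero_mem' := by
    intro k
    have : D^[k] 0 = 0 := by
      induction k with
      | zero => rfl
      | succ k ih => simp [Function.iterate_succ_apply, ih]
    rw [this]; exact Q.zero_mem
  add_mem' := by
    intro a b ha hb k
    rw [iter_add]; exact Q.add_mem (ha k) (hb k)
  smul_mem' := by
    intro c a ha k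
    rw [smul_eq_mul, iter_leibniz D hD]
    exact Q.sum_mem fun ij _ => Q.smul_of_tower_mem _ (Q.mul_mem_left _ (ha _))

lemma starI_prime [Algebra ℚ A] (D : A →+ A) (hD : ∀ a b, D (a * b) = a * D b + b * D a)
    (Q : Ideal A) (hQ : Q.IsPrime) : (starI D hD Q).IsPrime := by
  classical
  constructor
  · intro h
    apply hQ.ne_top
    rw [Ideal.eq_top_iff_one] at h ⊢
    exact h 0
  · intro a b hab
    by_contra hcon
    push Not at hcon
    obtain ⟨ha, hb⟩ := hcon
    have ha' : ∃ k, D^[k] a ∉ Q := by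
      by_contra h; push Not at h; exact ha h
    have hb' : ∃ k, D^[k] b ∉ Q := by
      by_contra h; push Not at h; exact hb h
    set i := Nat.find ha' with hi
    set j := Nat.find hb' with hj
    have h1 : D^[i] a ∉ Q := Nat.find_spec ha'
    have h2 : D^[j] b ∉ Q := Nat.find_spec hb'
    have h := hab (i + j)
    rw [iter_leibniz D hD, ← Finset.add_sum_erase _ _
      (show (i, j) ∈ Finset.HasAntidiagonal.antidiagonal (i + j) by simp)] at h
    have h3 : ∑ x ∈ (Finset.HasAntidiagonal.antidiagonal (i + j)).erase (i, j),
        (i + j).choose x.1 • (D^[x.1] a * D^[x.2] b) ∈ Q := by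
      refine Q.sum_mem fun x hx => Q.smul_of_tower_mem _ ?_
      simp only [Finset.mem_erase, Finset.HasAntidiagonal.mem_antidiagonal] at hx
      have : x.1 < i ∨ x.2 < j := by
        by_contra hh
        push Not at hh
        exact hx.1 (Prod.ext (by omega) (by omega))
      rcases this with h | h
      · exact Q.mul_mem_right _ (not_not.1 (Nat.find_min ha' h))
      · exact Q.mul_mem_left _ (not_not.1 (Nat.find_min hb' h))
    have h4 := (Submodule.add_mem_iff_left Q h3).1 h
    have h5 : D^[i] a * D^[j] b ∈ Q := by
      have hne : ((i+j).choose i : ℚ) ≠ 0 := by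
        exact_mod_cast (Nat.choose_pos (Nat.le_add_right i j)).ne'
      have := Q.smul_of_tower_mem (((i+j).choose i : ℚ)⁻¹) h4
      rw [← Nat.cast_smul_eq_nsmul ℚ, smul_smul, inv_mul_cancel₀ hne, one_smul] at this
      exact this
    rcases hQ.mem_or_mem h5 with h | h
    · exact h1 h
    · exact h2 h

end star

end DAEaux
namespace DAEaux

open MvPolynomial

set_option linter.unusedSectionVars false

section factA

variable {K L σ : Type} [Field K] [CharZero K] [Field L] [Algebra K L]

lemma aeval_const (τ : MvPolynomial σ K →ₐ[K] L) (p : MvPolynomial σ K) :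
    aeval (fun w => (PowerSeries.C (τ (X w)) : PowerSeries L)) p = PowerSeries.C (τ p) := by
  have : (aeval (fun w => (PowerSeries.C (τ (X w)) : PowerSeries L)) :
      MvPolynomial σ K →ₐ[K] PowerSeries L).toRingHom
    = PowerSeries.C.comp τ.toRingHom := by
    ext a
    · simp [PowerSeries.algebraMap_apply]
    · simp
  exact RingHom.congr_fun this p

lemma grad_mem_span (τ : MvPolynomial σ K →ₐ[K] L)
    (D : MvPolynomial σ K →+ MvPolynomial σ K) (hD : ∀ a b, D (a * b) = a * D b + b * D a)
    {r : ℕ} (f : Fin r → MvPolynomial σ K) (hker : ∀ t s, τ (D^[s] (f t)) = 0)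
    (hli : LinearIndependent L fun ρ : Fin r × ℕ => grad τ (D^[ρ.2] (f ρ.1)))
    (hmin : ∀ Q : Ideal (MvPolynomial σ K), Q.IsPrime → (∀ g ∈ Q, D g ∈ Q) → (∀ t, f t ∈ Q) →
      (∀ g ∈ Q, τ g = 0) → ∀ g, τ g = 0 → g ∈ Q)
    (p : MvPolynomial σ K) (hp : τ p = 0) :
    grad τ p ∈ Submodule.span L (Set.range fun ρ : Fin r × ℕ => grad τ (D^[ρ.2] (f ρ.1))) := by
  by_contra hcon
  obtain ⟨ℓ, hℓ, hle⟩ := Submodule.exists_le_ker_of_notMem hcon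
  apply hℓ
  have h1 : Finsupp.linearCombination L (fun w => ℓ (Finsupp.single w 1)) = ℓ := by
    ext w; simp
  obtain ⟨x, hx0, hx1, hxF⟩ := exists_curve τ (fun ρ : Fin r × ℕ => D^[ρ.2] (f ρ.1))
    (fun ρ => hker _ _) hli (fun w => ℓ (Finsupp.single w 1)) (by
      intro ρ
      rw [h1]
      exact hle (Submodule.subset_span ⟨ρ, rfl⟩))
  have hQ : (RingHom.ker (aeval x : MvPolynomial σ K →ₐ[K] PowerSeries L)).IsPrime :=
    RingHom.ker_isPrime _
  have hpx : aeval x p = 0 := by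
    have := hmin (starI D hD (RingHom.ker (aeval x : MvPolynomial σ K →ₐ[K] PowerSeries L)))
      (starI_prime D hD _ hQ) (by
        intro g hg k
        have := hg (k + 1)
        rwa [Function.iterate_succ_apply] at this) (by
        intro t k
        exact hxF (t, k)) (by
        intro g hg
        have h := hg 0
        rw [← constCoeff_aeval τ x hx0 g]
        have h : aeval x g = 0 := h
        rw [h, map_zero]) p hp
    exact this 0
  have := first_order τ x (fun w => (PowerSeries.C (τ (X w)) : PowerSeries L)) hx0
    (by intro w; simp) 1 (by
      intro w
      rw [PowerSeries.X_pow_dvd_iff]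
      intro k hk
      obtain rfl : k = 0 := by omega
      simp [hx0]) p
  rw [aeval_const, hpx, hp] at this
  have e : (fun w => PowerSeries.coeff 1 (x w - PowerSeries.C (τ (X w)))) =
    fun w => ℓ (Finsupp.single w 1) := by
    ext w
    rw [map_sub, hx1, PowerSeries.coeff_C]
    simp
  rw [e, h1] at this
  rw [← this]
  simp

lemma exists_minimal_rel (τ : MvPolynomial σ K →ₐ[K] L) (S T : Set σ)
    (_hST : S ⊆ T)
    (hS : ∀ p ∈ supported K S, τ p = 0 → p = 0)
    (hT : ¬ ∀ p ∈ supported K T, τ p = 0 → p = 0) :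
    ∃ p ∈ supported K T, τ p = 0 ∧ ∃ v ∈ T \ S, τ (pderiv v p) ≠ 0 := by
  classical
  have hex : ∃ N, ∃ p ∈ supported K T, τ p = 0 ∧ p ≠ 0 ∧ p.totalDegree = N := by
    push Not at hT
    obtain ⟨p, h1, h2, h3⟩ := hT
    exact ⟨_, p, h1, h2, h3, rfl⟩
  obtain ⟨p, h1, h2, h3, h4⟩ := Nat.find_spec hex
  have hnot : ¬ p ∈ supported K S := fun h => h3 (hS p h h2)
  rw [mem_supported, Set.not_subset] at hnot
  obtain ⟨v, hv, hvS⟩ := hnot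
  have hvT : v ∈ T := mem_supported.1 h1 hv
  refine ⟨p, h1, h2, v, ⟨hvT, hvS⟩, ?_⟩
  intro h0
  have hne : pderiv v p ≠ 0 := by
    rw [Finset.mem_coe, mem_vars_iff_mem_support] at hv
    obtain ⟨m, hm, hmv⟩ := hv
    intro h
    have hc := coeff_pderiv (i := v) p (m - Finsupp.single v 1)
    have hle : Finsupp.single v 1 ≤ m := by
      rw [Finsupp.single_le_iff]
      exact Nat.one_le_iff_ne_zero.2 (Finsupp.mem_support_iff.1 hmv)
    rw [tsub_add_cancel_of_le hle, h, coeff_zero] at hc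
    rcases mul_eq_zero.1 hc.symm with h | h
    · exact (mem_support_iff.1 hm) h
    · exact Nat.cast_add_one_ne_zero _ h
  have hsupp : ∀ m ∈ (pderiv v p).support, m + Finsupp.single v 1 ∈ p.support := by
    intro m hm
    rw [mem_support_iff, coeff_pderiv] at hm
    rw [mem_support_iff]
    exact left_ne_zero_of_mul hm
  have hsT : pderiv v p ∈ supported K T := by
    rw [mem_supported]
    intro w hw
    rw [Finset.mem_coe, mem_vars_iff_mem_support] at hw
    obtain ⟨m, hm, hmw⟩ := hw
    apply mem_supported.1 h1
    rw [Finset.mem_coe, mem_vars_iff_mem_support]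
    refine ⟨_, hsupp m hm, ?_⟩
    rw [Finsupp.mem_support_iff] at hmw ⊢
    simp only [Finsupp.add_apply]
    omega
  have hlt : (pderiv v p).totalDegree < p.totalDegree := by
    obtain ⟨m, hm, hmd⟩ := Finset.exists_mem_eq_sup _ (support_nonempty.2 hne)
      (fun s => s.sum fun _ e => e)
    have h5 := le_totalDegree (hsupp m hm)
    have h6 : (pderiv v p).totalDegree = m.sum fun _ e => e := hmd
    rw [h6]
    rw [Finsupp.sum_add_index' (by simp) (by simp), Finsupp.sum_single_index (by simp)] at h5
    omega
  exact Nat.find_min hex (h4 ▸ hlt) ⟨_, hsT, h0, hne, rfl⟩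

end factA

section shift

variable {K : Type} [Field K] {n : ℕ}

lemma D_one {A : Type} [CommRing A] (D : A →+ A) (hD : ∀ a b, D (a * b) = a * D b + b * D a) :
    D 1 = 0 := by
  have := hD 1 1
  simp at this
  exact this

lemma pderiv_D (D : MvPolynomial (Fin n × ℕ) K →+ MvPolynomial (Fin n × ℕ) K)
    (hD : ∀ a b, D (a * b) = a * D b + b * D a) (hC : ∀ a, ∃ b, D (C a) = C b)
    (hX : ∀ j l, D (X (j, l)) = X (j, l + 1)) (g : MvPolynomial (Fin n × ℕ) K)
    (j : Fin n) (l : ℕ) :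
    pderiv (j, l) (D g) = D (pderiv (j, l) g) + if l = 0 then 0 else pderiv (j, l - 1) g := by
  classical
  induction g using MvPolynomial.induction_on with
  | C a =>
    obtain ⟨b, hb⟩ := hC a
    rw [hb]
    simp
  | add p q hp hq =>
    simp only [map_add, hp, hq]
    split_ifs <;> ring
  | mul_X p w hp =>
    obtain ⟨j', l'⟩ := w
    have hc : ∀ v w : Fin n × ℕ, D (pderiv v (X w : MvPolynomial (Fin n × ℕ) K)) = 0 := by
      intro v w
      rw [pderiv_X, Pi.single_apply]
      split_ifs
      · exact D_one D hD
      · exact map_zero _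
    have hs : pderiv (j, l) (X (j', l' + 1) : MvPolynomial (Fin n × ℕ) K) =
        if l = 0 then 0 else pderiv (j, l - 1) (X (j', l')) := by
      rw [pderiv_X, pderiv_X, Pi.single_apply, Pi.single_apply]
      rcases l with _ | l
      · simp
      · simp
    rw [hD, map_add, pderiv_mul, pderiv_mul, pderiv_mul, hX, hs, hp, map_add, hD, hD, hc, hX]
    split_ifs
    · ring
    · rw [pderiv_mul]; ring

end shift

end DAEaux
namespace DAEaux

open MvPolynomial

set_option linter.unusedSectionVars false

section lower

variable {K L : Type} [Field K] [CharZero K] [Field L] [Algebra K L] {n r : ℕ}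

/-- span of the gradients of the derivatives of order `< c` -/
def Nc (τ : MvPolynomial (Fin n × ℕ) K →ₐ[K] L)
    (D : MvPolynomial (Fin n × ℕ) K →+ MvPolynomial (Fin n × ℕ) K)
    (f : Fin r → MvPolynomial (Fin n × ℕ) K) (c : ℕ) : Submodule L ((Fin n × ℕ) →₀ L) :=
  Submodule.span L (Set.range fun ρ : Fin r × Fin c => grad τ (D^[(ρ.2 : ℕ)] (f ρ.1)))

variable (τ : MvPolynomial (Fin n × ℕ) K →ₐ[K] L)
    (D : MvPolynomial (Fin n × ℕ) K →+ MvPolynomial (Fin n × ℕ) K)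
    (f : Fin r → MvPolynomial (Fin n × ℕ) K)

lemma Nc_mono {c c' : ℕ} (h : c ≤ c') : Nc τ D f c ≤ Nc τ D f c' := by
  apply Submodule.span_le.2
  rintro _ ⟨ρ, rfl⟩
  exact Submodule.subset_span ⟨(ρ.1, ⟨ρ.2, by omega⟩), rfl⟩

lemma finrank_Nc (c : ℕ) : Module.finrank L (Nc τ D f c) ≤ r * c := by
  have := finrank_range_le_card (R := L) (fun ρ : Fin r × Fin c => grad τ (D^[(ρ.2 : ℕ)] (f ρ.1)))
  rw [Fintype.card_prod, Fintype.card_fin, Fintype.card_fin] at this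
  exact this

instance (c : ℕ) : FiniteDimensional L (Nc τ D f c) :=
  FiniteDimensional.span_of_finite L (Set.finite_range _)

variable (hD : ∀ a b, D (a * b) = a * D b + b * D a) (hC : ∀ a, ∃ b, D (C a) = C b)
    (hX : ∀ j l, D (X (j, l)) = X (j, l + 1))
    (D' : L → L) (hD'add : ∀ a b, D' (a + b) = D' a + D' b)
    (hD'mul : ∀ a b, D' (a * b) = a * D' b + b * D' a)
    (hD'comp : ∀ g, D' (τ g) = τ (D g))

include hD hC hX hD'comp

lemma grad_D (g : MvPolynomial (Fin n × ℕ) K) (j : Fin n) (l : ℕ) :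
    grad τ (D g) (j, l) = D' (grad τ g (j, l)) + if l = 0 then 0 else grad τ g (j, l - 1) := by
  simp only [grad_apply]
  rw [pderiv_D D hD hC hX, map_add, hD'comp]
  split_ifs <;> simp

include hD'add hD'mul

lemma mem_Nc_succ (c : ℕ) (g : MvPolynomial (Fin n × ℕ) K) (hg : grad τ g ∈ Nc τ D f c) :
    grad τ (D g) ∈ Nc τ D f (c + 1) := by
  have D'0 : D' 0 = 0 := by simpa using hD'add 0 0
  have key : ∀ u ∈ Nc τ D f c, ∃ u' ∈ Nc τ D f (c + 1), ∀ j l,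
      u' (j, l) = D' (u (j, l)) + if l = 0 then 0 else u (j, l - 1) := by
    intro u hu
    induction hu using Submodule.span_induction with
    | mem u hu =>
      obtain ⟨ρ, rfl⟩ := hu
      refine ⟨grad τ (D (D^[(ρ.2 : ℕ)] (f ρ.1))), ?_, ?_⟩
      · refine Submodule.subset_span ⟨(ρ.1, ⟨ρ.2 + 1, by omega⟩), ?_⟩
        simp only [Function.iterate_succ_apply']
      · intro j l
        exact grad_D τ D hD hC hX D' hD'comp _ j l
    | zero => exact ⟨0, Submodule.zero_mem _, by simp [D'0]⟩
    | add u v _ _ hu hv =>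
      obtain ⟨u', h1, h2⟩ := hu
      obtain ⟨v', h3, h4⟩ := hv
      refine ⟨u' + v', Submodule.add_mem _ h1 h3, ?_⟩
      intro j l
      simp only [Finsupp.add_apply, h2, h4, hD'add]
      split_ifs <;> ring
    | smul a u hu' hu =>
      obtain ⟨u', h1, h2⟩ := hu
      refine ⟨D' a • u + a • u', Submodule.add_mem _
        (Submodule.smul_mem _ _ (Nc_mono τ D f (Nat.le_succ c) hu')) (Submodule.smul_mem _ _ h1), ?_⟩
      intro j l
      simp only [Finsupp.add_apply, Finsupp.smul_apply, smul_eq_mul, h2, hD'mul]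
      split_ifs <;> ring
  obtain ⟨u', h1, h2⟩ := key _ hg
  have : grad τ (D g) = u' := by
    ext ⟨j, l⟩
    rw [h2, grad_D τ D hD hC hX D' hD'comp]
  rw [this]
  exact h1

lemma mem_Nc_add (c s : ℕ) (g : MvPolynomial (Fin n × ℕ) K) (hg : grad τ g ∈ Nc τ D f c) :
    grad τ (D^[s] g) ∈ Nc τ D f (c + s) := by
  induction s with
  | zero => exact hg
  | succ s ih =>
    rw [Function.iterate_succ_apply']
    exact mem_Nc_succ τ D f hD hC hX D' hD'add hD'mul hD'comp _ _ ih

lemma lower (hker : ∀ t s, τ (D^[s] (f t)) = 0)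
    (hli : LinearIndependent L fun ρ : Fin r × ℕ => grad τ (D^[ρ.2] (f ρ.1)))
    (hmin : ∀ Q : Ideal (MvPolynomial (Fin n × ℕ) K), Q.IsPrime → (∀ g ∈ Q, D g ∈ Q) →
      (∀ t, f t ∈ Q) → (∀ g ∈ Q, τ g = 0) → ∀ g, τ g = 0 → g ∈ Q) :
    ∃ S : Finset (Fin n), n - r ≤ S.card ∧
      ∀ p ∈ supported K {v : Fin n × ℕ | v.1 ∈ S}, τ p = 0 → p = 0 := by
  classical
  have D'0 : D' 0 = 0 := by simpa using hD'add 0 0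
  let Ind : Finset (Fin n) → Prop := fun S =>
    ∀ p ∈ supported K {v : Fin n × ℕ | v.1 ∈ S}, τ p = 0 → p = 0
  have hempty : Ind ∅ := by
    intro p hp h0
    have : {v : Fin n × ℕ | v.1 ∈ (∅ : Finset (Fin n))} = ∅ := by ext; simp
    rw [this, supported_empty, Algebra.mem_bot] at hp
    obtain ⟨a, rfl⟩ := hp
    rw [AlgHom.commutes] at h0
    rw [(map_eq_zero_iff _ (algebraMap K L).injective).1 h0, map_zero]
  obtain ⟨S, hS, hmax⟩ := Finset.exists_max_image (Finset.univ.filter Ind) Finset.card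
    ⟨∅, by simpa using hempty⟩
  simp only [Finset.mem_filter, Finset.mem_univ, true_and] at hS hmax
  refine ⟨S, ?_, hS⟩
  -- relations
  have hrel : ∀ k : Fin n, k ∉ S → ∃ p : MvPolynomial (Fin n × ℕ) K, ∃ l c : ℕ,
      grad τ p ∈ Nc τ D f c ∧
      (∀ k' l', k' ∉ S → k' ≠ k → grad τ p (k', l') = 0) ∧
      (∀ l' > l, grad τ p (k, l') = 0) ∧ grad τ p (k, l) ≠ 0 := by
    intro k hk
    have hnot : ¬ Ind (insert k S) := by
      intro h
      have := hmax _ h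
      rw [Finset.card_insert_of_notMem hk] at this
      omega
    obtain ⟨p, hp1, hp2, v, hv, hv'⟩ := exists_minimal_rel τ {v : Fin n × ℕ | v.1 ∈ S}
      {v : Fin n × ℕ | v.1 ∈ insert k S} (fun v hv => Finset.mem_insert_of_mem hv) hS hnot
    have hvk : v.1 = k := by
      obtain ⟨h1, h2⟩ := hv
      exact (Finset.mem_insert.1 h1).resolve_right h2
    have hfin : ∃ c, grad τ p ∈ Nc τ D f c := by
      have := grad_mem_span τ D hD f hker hli hmin p hp2
      generalize grad τ p = u at this ⊢
      induction this using Submodule.span_induction with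
      | mem u hu =>
        obtain ⟨ρ, rfl⟩ := hu
        exact ⟨ρ.2 + 1, Submodule.subset_span ⟨(ρ.1, ⟨ρ.2, by omega⟩), rfl⟩⟩
      | zero => exact ⟨0, Submodule.zero_mem _⟩
      | add u v _ _ hu hv =>
        obtain ⟨c, hc⟩ := hu
        obtain ⟨c', hc'⟩ := hv
        exact ⟨max c c', Submodule.add_mem _ (Nc_mono τ D f (le_max_left _ _) hc)
          (Nc_mono τ D f (le_max_right _ _) hc')⟩
      | smul a u _ hu =>
        obtain ⟨c, hc⟩ := hu
        exact ⟨c, Submodule.smul_mem _ _ hc⟩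
    obtain ⟨c, hc⟩ := hfin
    obtain ⟨w, hw, hwmax⟩ := Finset.exists_max_image
      ((grad τ p).support.filter fun w => w.1 = k) (fun w => w.2)
      ⟨v, by simpa using ⟨hv', hvk⟩⟩
    simp only [Finset.mem_filter, Finsupp.mem_support_iff] at hw hwmax
    refine ⟨p, w.2, c, hc, ?_, ?_, ?_⟩
    · intro k' l' h1 h2
      rw [grad_apply, pderiv_eq_zero_of_notMem_vars, map_zero]
      intro h3
      have := mem_supported.1 hp1 h3
      exact (Finset.mem_insert.1 this).elim h2 h1
    · intro l' hl'
      by_contra h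
      have := hwmax (k, l') ⟨h, rfl⟩
      simp at this
      omega
    · have : (k, w.2) = w := by rw [← hw.2]
      rw [this]
      exact hw.1
  choose! p l c hpc hp0 hpl hpn using hrel
  -- iterate
  have hz : ∀ s k, k ∉ S → ∀ k' l', k' ∉ S → k' ≠ k → grad τ (D^[s] (p k)) (k', l') = 0 := by
    intro s k hk
    induction s with
    | zero => exact hp0 k hk
    | succ s ih =>
      intro k' l' h1 h2
      rw [Function.iterate_succ_apply', grad_D τ D hD hC hX D' hD'comp, ih _ _ h1 h2, ih _ _ h1 h2, D'0]
      simp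
  have ht : ∀ s k, k ∉ S → (∀ l' > l k + s, grad τ (D^[s] (p k)) (k, l') = 0) ∧
      grad τ (D^[s] (p k)) (k, l k + s) ≠ 0 := by
    intro s k hk
    induction s with
    | zero => exact ⟨hpl k hk, hpn k hk⟩
    | succ s ih =>
      refine ⟨?_, ?_⟩
      · intro l' hl'
        rw [Function.iterate_succ_apply', grad_D τ D hD hC hX D' hD'comp, ih.1 _ (by omega),
          ih.1 _ (by omega), D'0]
        simp
      · rw [Function.iterate_succ_apply', grad_D τ D hD hC hX D' hD'comp, ih.1 _ (by omega), D'0,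
          if_neg (by omega), zero_add]
        exact ih.2
  have hind : LinearIndependent L fun q : {k // k ∉ S} × ℕ => grad τ (D^[q.2] (p q.1)) := by
    rw [linearIndependent_iff']
    intro F a ha
    by_contra hcon
    push Not at hcon
    obtain ⟨q₀, hq₀, hq₀a⟩ := hcon
    obtain ⟨q, hq, hqmax⟩ := Finset.exists_max_image
      (F.filter fun q => q.1 = q₀.1 ∧ a q ≠ 0) (fun q => q.2) ⟨q₀, by simp [hq₀, hq₀a]⟩
    simp only [Finset.mem_filter] at hq hqmax
    have h := DFunLike.congr_fun ha ((q.1 : Fin n), l q.1 + q.2)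
    rw [Finsupp.finsetSum_apply, Finset.sum_eq_single_of_mem q hq.1] at h
    · simp only [Finsupp.smul_apply, smul_eq_mul, Finsupp.zero_apply] at h
      rcases mul_eq_zero.1 h with h | h
      · exact hq.2.2 h
      · exact (ht q.2 q.1 q.1.2).2 h
    · intro b hb hbq
      simp only [Finsupp.smul_apply, smul_eq_mul]
      by_cases hb1 : b.1 = q.1
      · by_cases hab : a b = 0
        · rw [hab, zero_mul]
        · have hle := hqmax b ⟨hb, hb1.trans hq.2.1, hab⟩
          have hne : b.2 ≠ q.2 := fun h => hbq (Prod.ext hb1 h)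
          rw [← hb1, (ht b.2 b.1 b.1.2).1 _ (by omega), mul_zero]
      · rw [hz b.2 b.1 b.1.2 _ _ q.1.2 (fun h => hb1 (Subtype.ext h.symm)), mul_zero]
  let c₀ := Finset.univ.sup c
  have hcount : ∀ M, (n - S.card) * M ≤ r * (c₀ + M) := by
    intro M
    have hmem : ∀ q : {k // k ∉ S} × Fin M, grad τ (D^[(q.2 : ℕ)] (p q.1)) ∈ Nc τ D f (c₀ + M) := by
      intro q
      refine Nc_mono τ D f ?_ (mem_Nc_add τ D f hD hC hX D' hD'add hD'mul hD'comp (c q.1) q.2 _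
        (hpc q.1 q.1.2))
      have : c q.1 ≤ c₀ := Finset.le_sup (Finset.mem_univ _)
      omega
    have hi2 : LinearIndependent L fun q : {k // k ∉ S} × Fin M =>
        (⟨grad τ (D^[(q.2 : ℕ)] (p q.1)), hmem q⟩ : Nc τ D f (c₀ + M)) := by
      apply LinearIndependent.of_comp (Nc τ D f (c₀ + M)).subtype
      exact hind.comp (fun q : {k // k ∉ S} × Fin M => (q.1, (q.2 : ℕ))) (by
        rintro ⟨a, b⟩ ⟨a', b'⟩ h
        simp only [Prod.mk.injEq] at h
        exact Prod.ext h.1 (Fin.ext h.2))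
    have := hi2.fintype_card_le_finrank.trans (finrank_Nc τ D f _)
    simpa [Fintype.card_subtype_compl] using this
  by_contra hlt
  have h1 : r + 1 ≤ n - S.card := by omega
  have h2 := hcount (r * c₀ + 1)
  have h3 := Nat.mul_le_mul_right (r * c₀ + 1) h1
  nlinarith

end lower

end DAEaux
namespace DAEaux

open MvPolynomial

set_option linter.unusedSectionVars false

section kaehler

variable {K L : Type} [Field K] [CharZero K] [Field L] [Algebra K L]

open scoped IntermediateField.algebraAdjoinAdjoin in
lemma etale_adjoin {ι : Type} {v : ι → L} (hb : IsTranscendenceBasis K v) :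
    Algebra.FormallyEtale (Algebra.adjoin K (Set.range v)) L := by
  have : Algebra.FormallyEtale (Algebra.adjoin K (Set.range v))
      (IntermediateField.adjoin K (Set.range v)) :=
    .of_isLocalization (nonZeroDivisors _)
  have : Algebra.IsAlgebraic (IntermediateField.adjoin K (Set.range v)) L := hb.isAlgebraic_field
  have : CharZero (IntermediateField.adjoin K (Set.range v)) :=
    charZero_of_injective_algebraMap (algebraMap K _).injective
  have : Algebra.FormallyEtale (IntermediateField.adjoin K (Set.range v)) L :=
    Algebra.FormallyEtale.of_isSeparable _ L
  exact .comp _ (IntermediateField.adjoin K (Set.range v)) _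

lemma li_D_basis {ι : Type} {v : ι → L} (hb : IsTranscendenceBasis K v) :
    LinearIndependent L fun i => KaehlerDifferential.D K L (v i) := by
  have h1 := etale_adjoin hb
  letI a1 : Algebra (MvPolynomial ι K) (Algebra.adjoin K (Set.range v)) :=
    hb.1.aevalEquiv.toRingEquiv.toRingHom.toAlgebra
  letI a2 : Algebra (MvPolynomial ι K) L := (aeval v : MvPolynomial ι K →ₐ[K] L).toRingHom.toAlgebra
  have t1 : IsScalarTower (MvPolynomial ι K) (Algebra.adjoin K (Set.range v)) L :=
    IsScalarTower.of_algebraMap_eq fun x => by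
      change aeval v x = ((hb.1.aevalEquiv x : Algebra.adjoin K (Set.range v)) : L)
      simp
  have t2 : IsScalarTower K (MvPolynomial ι K) L :=
    IsScalarTower.of_algebraMap_eq fun x => by
      change _ = aeval v (algebraMap K (MvPolynomial ι K) x)
      rw [AlgHom.commutes]
  have h2 : Algebra.FormallyEtale (MvPolynomial ι K) (Algebra.adjoin K (Set.range v)) :=
    Algebra.FormallyEtale.of_equiv (A := MvPolynomial ι K)
      (AlgEquiv.ofRingEquiv (f := hb.1.aevalEquiv.toRingEquiv) (fun x => rfl))
  have h3 : Algebra.FormallyEtale (MvPolynomial ι K) L :=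
    .comp _ (Algebra.adjoin K (Set.range v)) _
  let b := ((KaehlerDifferential.mvPolynomialBasis K ι).baseChange L).map
    (KaehlerDifferential.tensorKaehlerEquivOfFormallyEtale K (MvPolynomial ι K) L)
  have := b.linearIndependent
  convert this with i
  simp only [b, Module.Basis.map_apply, Module.Basis.baseChange_apply,
    KaehlerDifferential.mvPolynomialBasis_apply,
    KaehlerDifferential.tensorKaehlerEquivOfFormallyEtale_apply,
    KaehlerDifferential.mapBaseChange_tmul, one_smul, KaehlerDifferential.map_D]
  congr 1
  change v i = aeval v (X i)
  simp

lemma li_D {ι : Type} {y : ι → L} (hy : AlgebraicIndependent K y) :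
    LinearIndependent L fun i => KaehlerDifferential.D K L (y i) := by
  have h1 : AlgebraicIndepOn K id (Set.range y) := hy.to_subtype_range
  obtain ⟨t, ht, hb⟩ := exists_isTranscendenceBasis_superset h1
  have := li_D_basis hb
  exact this.comp (fun i => (⟨y i, ht ⟨i, rfl⟩⟩ : t)) (by
    intro i j h
    exact hy.injective (Subtype.ext_iff.1 h))

end kaehler

section upper

variable {K L : Type} [Field K] [CharZero K] [Field L] [Algebra K L] {n r : ℕ}

variable (τ : MvPolynomial (Fin n × ℕ) K →ₐ[K] L)
    (D : MvPolynomial (Fin n × ℕ) K →+ MvPolynomial (Fin n × ℕ) K)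
    (f : Fin r → MvPolynomial (Fin n × ℕ) K)

/-- polynomials of order `< M` -/
def Sup (K : Type) [Field K] (n M : ℕ) : Subalgebra K (MvPolynomial (Fin n × ℕ) K) :=
  supported K {v : Fin n × ℕ | v.2 < M}

lemma Sup_mono {M M' : ℕ} (h : M ≤ M') : Sup K n M ≤ Sup K n M' :=
  supported_mono fun v (hv : v.2 < M) => lt_of_lt_of_le hv h

lemma Sup_D (hD : ∀ a b, D (a * b) = a * D b + b * D a) (hC : ∀ a, ∃ b, D (C a) = C b)
    (hX : ∀ j l, D (X (j, l)) = X (j, l + 1)) (M : ℕ) (g : MvPolynomial (Fin n × ℕ) K)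
    (hg : g ∈ Sup K n M) : D g ∈ Sup K n (M + 1) := by
  have hle := Sup_mono (K := K) (n := n) (Nat.le_succ M)
  change g ∈ Algebra.adjoin K (X '' {v : Fin n × ℕ | v.2 < M}) at hg
  have hg' : g ∈ Sup K n M ∧ D g ∈ Sup K n (M + 1) := by
    induction hg using Algebra.adjoin_induction with
    | mem x hx =>
      obtain ⟨⟨j, l⟩, hv, rfl⟩ := hx
      refine ⟨X_mem_supported.2 hv, ?_⟩
      rw [hX]
      exact X_mem_supported.2 (Nat.succ_lt_succ hv)
    | algebraMap a =>
      refine ⟨Subalgebra.algebraMap_mem _ _, ?_⟩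
      obtain ⟨b, hb⟩ := hC a
      rw [MvPolynomial.algebraMap_eq, hb]
      exact Subalgebra.algebraMap_mem _ _
    | add x y _ _ hx hy =>
      exact ⟨add_mem hx.1 hy.1, by rw [map_add]; exact add_mem hx.2 hy.2⟩
    | mul x y _ _ hx hy =>
      refine ⟨mul_mem hx.1 hy.1, ?_⟩
      rw [hD]
      exact add_mem (mul_mem (hle hx.1) hy.2) (mul_mem (hle hy.1) hx.2)
  exact hg'.2

lemma Sup_iter (hD : ∀ a b, D (a * b) = a * D b + b * D a) (hC : ∀ a, ∃ b, D (C a) = C b)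
    (hX : ∀ j l, D (X (j, l)) = X (j, l + 1)) (M s : ℕ) (g : MvPolynomial (Fin n × ℕ) K)
    (hg : g ∈ Sup K n M) : D^[s] g ∈ Sup K n (M + s) := by
  induction s with
  | zero => exact hg
  | succ s ih =>
    rw [Function.iterate_succ_apply']
    exact Sup_D D hD hC hX _ _ ih

/-- fractions of order `< M` -/
def Fr (M : ℕ) (z : L) : Prop := ∃ a ∈ Sup K n M, ∃ b ∈ Sup K n M, τ b ≠ 0 ∧ z = τ a / τ b

lemma Fr_D (hD : ∀ a b, D (a * b) = a * D b + b * D a) (hC : ∀ a, ∃ b, D (C a) = C b)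
    (hX : ∀ j l, D (X (j, l)) = X (j, l + 1))
    (D' : L → L)
    (hD'mul : ∀ a b, D' (a * b) = a * D' b + b * D' a)
    (hD'comp : ∀ g, D' (τ g) = τ (D g)) (M : ℕ) (z : L) (hz : Fr τ M z) :
    Fr τ (M + 1) (D' z) := by
  obtain ⟨a, ha, b, hb, hb0, rfl⟩ := hz
  have hle := Sup_mono (K := K) (n := n) (Nat.le_succ M)
  refine ⟨b * D a - a * D b, sub_mem (mul_mem (hle hb) (Sup_D D hD hC hX _ _ ha))
    (mul_mem (hle ha) (Sup_D D hD hC hX _ _ hb)), b * b, mul_mem (hle hb) (hle hb), ?_, ?_⟩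
  · rw [map_mul]; exact mul_ne_zero hb0 hb0
  · have h := hD'mul (τ a / τ b) (τ b)
    rw [div_mul_cancel₀ _ hb0, hD'comp, hD'comp] at h
    rw [map_sub, map_mul, map_mul, map_mul, h]
    field_simp
    ring

lemma Fr_iter (hD : ∀ a b, D (a * b) = a * D b + b * D a) (hC : ∀ a, ∃ b, D (C a) = C b)
    (hX : ∀ j l, D (X (j, l)) = X (j, l + 1))
    (D' : L → L)
    (hD'mul : ∀ a b, D' (a * b) = a * D' b + b * D' a)
    (hD'comp : ∀ g, D' (τ g) = τ (D g)) (M s : ℕ) (z : L) (hz : Fr τ M z) :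
    Fr τ (M + s) (D'^[s] z) := by
  induction s with
  | zero => exact hz
  | succ s ih =>
    rw [Function.iterate_succ_apply']
    exact Fr_D τ D hD hC hX D' hD'mul hD'comp _ _ ih

/-- span of the differentials of the variables of order `< M` -/
def UM (M : ℕ) : Submodule L (Ω[L⁄K]) :=
  LinearMap.range (Fintype.linearCombination L
    (fun q : Fin n × Fin M => KaehlerDifferential.D K L (τ (X (q.1, (q.2 : ℕ))))))

lemma d_chain (p : MvPolynomial (Fin n × ℕ) K) :
    KaehlerDifferential.D K L (τ p) =
      Finsupp.linearCombination L (fun v => KaehlerDifferential.D K L (τ (X v))) (grad τ p) := by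
  refine chain τ (fun p => KaehlerDifferential.D K L (τ p)) ?_ ?_ ?_ p
  · intro p q; simp
  · intro a
    rw [← MvPolynomial.algebraMap_eq, AlgHom.commutes, Derivation.map_algebraMap]
  · intro p q; simp

lemma d_chain_fin (M : ℕ) (p : MvPolynomial (Fin n × ℕ) K) (hp : p ∈ Sup K n M) :
    KaehlerDifferential.D K L (τ p) = Fintype.linearCombination L
      (fun q : Fin n × Fin M => KaehlerDifferential.D K L (τ (X (q.1, (q.2 : ℕ)))))
      (fun q => τ (pderiv (q.1, (q.2 : ℕ)) p)) := by
  classical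
  rw [d_chain, Fintype.linearCombination_apply, Finsupp.linearCombination_apply]
  let ι : Fin n × Fin M ↪ Fin n × ℕ := ⟨fun q => (q.1, (q.2 : ℕ)), by
    rintro ⟨a, b⟩ ⟨a', b'⟩ h
    simp only [Prod.mk.injEq] at h
    exact Prod.ext h.1 (Fin.ext h.2)⟩
  rw [Finsupp.sum_of_support_subset (s := Finset.univ.map ι)]
  · rw [Finset.sum_map]
    rfl
  · intro v hv
    rw [Finsupp.mem_support_iff, grad_apply] at hv
    have hv' : v ∈ p.vars := by
      by_contra h
      exact hv (by rw [pderiv_eq_zero_of_notMem_vars h, map_zero])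
    have : v.2 < M := mem_supported.1 hp hv'
    exact Finset.mem_map.2 ⟨(v.1, ⟨v.2, this⟩), Finset.mem_univ _, rfl⟩
  · simp

lemma Fr_mem (M : ℕ) (z : L) (hz : Fr τ M z) : KaehlerDifferential.D K L z ∈ UM τ M := by
  obtain ⟨a, ha, b, hb, hb0, rfl⟩ := hz
  rw [Derivation.leibniz_div]
  have h : ∀ p ∈ Sup K n M, KaehlerDifferential.D K L (τ p) ∈ UM τ M := fun p hp =>
    ⟨_, (d_chain_fin τ M p hp).symm⟩
  exact Submodule.smul_mem _ _ (Submodule.sub_mem _ (Submodule.smul_mem _ _ (h a ha))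
    (Submodule.smul_mem _ _ (h b hb)))

instance (M : ℕ) : FiniteDimensional L (UM τ M) := by
  unfold UM; infer_instance

lemma finrank_UM (hD : ∀ a b, D (a * b) = a * D b + b * D a) (hC : ∀ a, ∃ b, D (C a) = C b)
    (hX : ∀ j l, D (X (j, l)) = X (j, l + 1))
    (e i : ℕ) (hf : ∀ t, f t ∈ Sup K n (e + 1)) (hker : ∀ t s, τ (D^[s] (f t)) = 0)
    (hrow : LinearIndependent L fun (p : Fin r × Fin i) (q : Fin n × Fin (i + e)) =>
      τ (pderiv (q.1, (q.2 : ℕ)) (D^[(p.2 : ℕ)] (f p.1)))) :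
    Module.finrank L (UM τ (i + e)) + r * i ≤ n * (i + e) := by
  have h := LinearMap.finrank_range_add_finrank_ker (Fintype.linearCombination L
    (fun q : Fin n × Fin (i + e) => KaehlerDifferential.D K L (τ (X (q.1, (q.2 : ℕ))))))
  rw [Module.finrank_fintype_fun_eq_card, Fintype.card_prod, Fintype.card_fin, Fintype.card_fin] at h
  have hmem : ∀ p : Fin r × Fin i, (fun q : Fin n × Fin (i + e) =>
      τ (pderiv (q.1, (q.2 : ℕ)) (D^[(p.2 : ℕ)] (f p.1)))) ∈ LinearMap.ker
      (Fintype.linearCombination L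
        (fun q : Fin n × Fin (i + e) => KaehlerDifferential.D K L (τ (X (q.1, (q.2 : ℕ)))))) := by
    intro p
    rw [LinearMap.mem_ker, ← d_chain_fin τ (i + e), hker, map_zero]
    exact Sup_mono (by have := p.2.2; omega) (Sup_iter D hD hC hX (e + 1) p.2 _ (hf p.1))
  have hli : LinearIndependent L fun p : Fin r × Fin i => (⟨_, hmem p⟩ : LinearMap.ker
      (Fintype.linearCombination L
        (fun q : Fin n × Fin (i + e) => KaehlerDifferential.D K L (τ (X (q.1, (q.2 : ℕ))))))) := by
    apply LinearIndependent.of_comp (Submodule.subtype _)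
    exact hrow
  have h2 := hli.fintype_card_le_finrank
  rw [Fintype.card_prod, Fintype.card_fin, Fintype.card_fin] at h2
  have h3 : Module.finrank L (UM τ (i + e)) = _ := rfl
  unfold UM at h3 ⊢
  omega

lemma upper (hrn : r ≤ n)
    (hD : ∀ a b, D (a * b) = a * D b + b * D a) (hC : ∀ a, ∃ b, D (C a) = C b)
    (hX : ∀ j l, D (X (j, l)) = X (j, l + 1))
    (D' : L → L)
    (hD'mul : ∀ a b, D' (a * b) = a * D' b + b * D' a)
    (hD'comp : ∀ g, D' (τ g) = τ (D g))
    (hsurj : ∀ z : L, ∃ a b, τ b ≠ 0 ∧ z = τ a / τ b)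
    (e : ℕ) (hf : ∀ t, f t ∈ Sup K n (e + 1)) (hker : ∀ t s, τ (D^[s] (f t)) = 0)
    (hrow : ∀ i, 1 ≤ i → LinearIndependent L fun (p : Fin r × Fin i) (q : Fin n × Fin (i + e)) =>
      τ (pderiv (q.1, (q.2 : ℕ)) (D^[(p.2 : ℕ)] (f p.1))))
    (d : ℕ) (y : Fin d → L)
    (hy : AlgebraicIndependent K fun p : Fin d × ℕ => D'^[p.2] (y p.1)) : d ≤ n - r := by
  have hSup : ∀ p : MvPolynomial (Fin n × ℕ) K, ∃ M, p ∈ Sup K n M := by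
    intro p
    refine ⟨p.vars.sup (fun v => v.2) + 1, mem_supported.2 fun v hv => ?_⟩
    exact Nat.lt_succ_of_le (Finset.le_sup (f := fun v : Fin n × ℕ => v.2) hv)
  have hFr : ∀ z : L, ∃ M, Fr τ M z := by
    intro z
    obtain ⟨a, b, hb, hz⟩ := hsurj z
    obtain ⟨M, hM⟩ := hSup a
    obtain ⟨M', hM'⟩ := hSup b
    exact ⟨max M M', a, Sup_mono (le_max_left _ _) hM, b, Sup_mono (le_max_right _ _) hM', hb, hz⟩
  choose M hM using fun i => hFr (y i)
  let M₀ := Finset.univ.sup M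
  have hM₀ : ∀ i, Fr τ M₀ (y i) := by
    intro i
    obtain ⟨a, ha, b, hb, h⟩ := hM i
    have hle : M i ≤ M₀ := Finset.le_sup (Finset.mem_univ i)
    exact ⟨a, Sup_mono hle ha, b, Sup_mono hle hb, h⟩
  have hcount : ∀ N, d * N ≤ Module.finrank L (UM τ ((M₀ + N + 1) + e)) := by
    intro N
    have hmem : ∀ p : Fin d × Fin N, KaehlerDifferential.D K L (D'^[(p.2 : ℕ)] (y p.1)) ∈
        UM τ ((M₀ + N + 1) + e) := by
      intro p
      apply Fr_mem
      obtain ⟨a, ha, b, hb, h⟩ := Fr_iter τ D hD hC hX D' hD'mul hD'comp M₀ p.2 _ (hM₀ p.1)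
      have hle : M₀ + (p.2 : ℕ) ≤ (M₀ + N + 1) + e := by omega
      exact ⟨a, Sup_mono hle ha, b, Sup_mono hle hb, h⟩
    have hli : LinearIndependent L fun p : Fin d × Fin N =>
        (⟨_, hmem p⟩ : UM τ ((M₀ + N + 1) + e)) := by
      apply LinearIndependent.of_comp (Submodule.subtype _)
      exact (li_D hy).comp (fun q : Fin d × Fin N => (q.1, (q.2 : ℕ))) (by
        rintro ⟨a, b⟩ ⟨a', b'⟩ h
        simp only [Prod.mk.injEq] at h
        exact Prod.ext h.1 (Fin.ext h.2))
    have := hli.fintype_card_le_finrank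
    rwa [Fintype.card_prod, Fintype.card_fin, Fintype.card_fin] at this
  by_contra hlt
  obtain ⟨m, rfl⟩ := Nat.exists_eq_add_of_le hrn
  have h1 : m + 1 ≤ d := by omega
  let N := m * (M₀ + 1 + e) + r * e + 1
  have h2 := hcount N
  have h3 := finrank_UM τ D f hD hC hX e (M₀ + N + 1) hf hker (hrow _ (by omega))
  have h4 := Nat.mul_le_mul_right N h1
  have h5 : (m + 1) * N + r * (M₀ + N + 1) ≤ (r + m) * (M₀ + N + 1 + e) := by omega
  have h6 : N = m * (M₀ + 1 + e) + r * e + 1 := rfl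
  nlinarith

end upper

end DAEaux

namespace DAEaux

open MvPolynomial

section fin
variable {K L : Type} [Field K] [CharZero K] [Field L] [Algebra K L] {n r : ℕ}

lemma li_rows {m q : Type} [Fintype m] [Fintype q] (A : Matrix m q L)
    (h : A.rank = Fintype.card m) : LinearIndependent L A.row := by
  rw [linearIndependent_iff_card_eq_finrank_span, ← h, Matrix.rank_eq_finrank_span_row]
  rfl

lemma hli_of_hrow (τ : MvPolynomial (Fin n × ℕ) K →ₐ[K] L)
    (G : Fin r × ℕ → MvPolynomial (Fin n × ℕ) K) (e : ℕ)
    (hrow : ∀ i, 1 ≤ i → LinearIndependent L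
      fun (p : Fin r × Fin i) (q : Fin n × Fin (i + e)) =>
      τ (pderiv (q.1, (q.2 : ℕ)) (G (p.1, p.2)))) :
    LinearIndependent L fun ρ : Fin r × ℕ => grad τ (G ρ) := by
  classical
  rw [linearIndependent_iff']
  intro s c hc ρ hρ
  set i := s.sup (fun v => v.2) + 1 with hi
  have hlt : ∀ v ∈ s, v.2 < i := fun v hv =>
    Nat.lt_succ_of_le (Finset.le_sup (f := fun v : Fin r × ℕ => v.2) hv)
  have h := Fintype.linearIndependent_iff.1 (hrow i (by omega))
    (fun p => if ((p.1, (p.2 : ℕ)) : Fin r × ℕ) ∈ s then c (p.1, p.2) else 0) ?_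
    (ρ.1, ⟨ρ.2, hlt ρ hρ⟩)
  · simpa [hρ] using h
  · funext q
    have h2 := DFunLike.congr_fun hc (q.1, (q.2 : ℕ))
    simp only [Finsupp.coe_finset_sum, Finset.sum_apply, Finsupp.coe_smul, Pi.smul_apply,
      grad_apply, smul_eq_mul, Finsupp.coe_zero, Pi.zero_apply] at h2
    simp only [Finset.sum_apply, Pi.smul_apply, smul_eq_mul, Pi.zero_apply, ite_mul, zero_mul]
    rw [← Finset.sum_filter, ← h2]
    refine Finset.sum_bij (fun p _ => (p.1, (p.2 : ℕ))) ?_ ?_ ?_ ?_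
    · intro a ha; exact (Finset.mem_filter.1 ha).2
    · intro a _ b _ hab
      simp only [Prod.mk.injEq] at hab
      exact Prod.ext hab.1 (Fin.ext hab.2)
    · intro b hb
      exact ⟨(b.1, ⟨b.2, hlt b hb⟩), by simpa using hb, rfl⟩
    · intro a _; rfl

lemma final (τ : MvPolynomial (Fin n × ℕ) K →ₐ[K] L)
    (D : MvPolynomial (Fin n × ℕ) K →+ MvPolynomial (Fin n × ℕ) K)
    (f : Fin r → MvPolynomial (Fin n × ℕ) K) (hrn : r ≤ n)
    (hD : ∀ a b, D (a * b) = a * D b + b * D a) (hC : ∀ a, ∃ b, D (C a) = C b)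
    (hX : ∀ j l, D (X (j, l)) = X (j, l + 1))
    (D' : L → L)
    (hD'add : ∀ a b, D' (a + b) = D' a + D' b)
    (hD'mul : ∀ a b, D' (a * b) = a * D' b + b * D' a)
    (hD'comp : ∀ g, D' (τ g) = τ (D g))
    (hsurj : ∀ z : L, ∃ a b, τ b ≠ 0 ∧ z = τ a / τ b)
    (e : ℕ) (hf : ∀ t, f t ∈ Sup K n (e + 1)) (hker : ∀ t s, τ (D^[s] (f t)) = 0)
    (hrow : ∀ i, 1 ≤ i → LinearIndependent L fun (p : Fin r × Fin i) (q : Fin n × Fin (i + e)) =>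
      τ (pderiv (q.1, (q.2 : ℕ)) (D^[(p.2 : ℕ)] (f p.1))))
    (hmin : ∀ Q : Ideal (MvPolynomial (Fin n × ℕ) K), Q.IsPrime → (∀ g ∈ Q, D g ∈ Q) →
      (∀ t, f t ∈ Q) → (∀ g ∈ Q, τ g = 0) → ∀ g, τ g = 0 → g ∈ Q) :
    (∃ y : Fin (n - r) → L,
        AlgebraicIndependent K fun p : Fin (n - r) × ℕ => D'^[p.2] (y p.1)) ∧
      ∀ d : ℕ, (∃ y : Fin d → L,
          AlgebraicIndependent K fun p : Fin d × ℕ => D'^[p.2] (y p.1)) → d ≤ n - r := by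
  constructor
  · have hli := hli_of_hrow τ (fun ρ => D^[ρ.2] (f ρ.1)) e hrow
    obtain ⟨S, hS, hInd⟩ := lower τ D f hD hC hX D' hD'add hD'mul hD'comp hker hli hmin
    let ι := S.orderEmbOfCardLe hS
    refine ⟨fun i => τ (X (ι i, 0)), ?_⟩
    have hit : ∀ (l : ℕ) (j : Fin n), D'^[l] (τ (X (j, 0))) = τ (X (j, l)) := by
      intro l j
      induction l with
      | zero => rfl
      | succ l ih => rw [Function.iterate_succ_apply', ih, hD'comp, hX]
    simp only [hit]
    let φ : Fin (n - r) × ℕ → Fin n × ℕ := fun p => (ι p.1, p.2)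
    have hφ : Function.Injective φ := by
      intro a b hab
      simp only [φ, Prod.mk.injEq] at hab
      exact Prod.ext (ι.injective hab.1) hab.2
    rw [algebraicIndependent_iff]
    intro p hp
    have h1 : τ (rename φ p) = 0 := by
      rw [← hp]
      have : τ.comp (rename φ) = aeval (fun p : Fin (n - r) × ℕ => τ (X (ι p.1, p.2))) := by
        ext i; simp [φ]
      exact DFunLike.congr_fun this p
    have h2 : rename φ p ∈ supported K {v : Fin n × ℕ | v.1 ∈ S} := by
      classical
      rw [mem_supported]
      intro v hv
      have := vars_rename φ p hv
      obtain ⟨w, _, rfl⟩ := Finset.mem_image.1 this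
      exact S.orderEmbOfCardLe_mem hS w.1
    exact rename_injective φ hφ (by rw [hInd _ h2 h1, map_zero])
  · rintro d ⟨y, hy⟩
    exact upper τ D f hrn hD hC hX D' hD'mul hD'comp hsurj e hf hker hrow d y hy

end fin

end DAEaux

namespace DAE

open MvPolynomial

/-- If `(Σ)` is quasi-regular at the minimal prime differential ideal
`𝔓` and `𝕂 = Frac(K{X}/𝔓)` is its residual (differential) field, then the differential
transcendence degree of `𝕂` over `K` is `n − r`: there is a differentially algebraically
independent family of `n − r` elements, and no larger one. Here `D'` is the induced
derivation of `𝕂`. -/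
theorem diff_trdeg_residualField_eq
    {K : Type} [Field K] [CharZero K] {n r : ℕ} (hrn : r ≤ n)
    (δ : K → K) (hδ : IsDeriv K δ)
    (D : DP K n → DP K n) (hD : IsTotalDeriv K n δ D)
    (f : Fin r → DP K n)
    (e : ℕ) (he : e = Finset.univ.sup fun p : Fin r × Fin n => ordIn (f p.1) p.2)
    (he1 : 1 ≤ e)
    (𝔓 : Ideal (DP K n)) [𝔓.IsPrime]
    (hmin : IsMinimalPrimeDiff D f 𝔓)
    (hqr : IsQuasiRegularAt D f 𝔓 e)
    (D' : KK K n 𝔓 → KK K n 𝔓)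
    (hD'add : ∀ a b, D' (a + b) = D' a + D' b)
    (hD'mul : ∀ a b, D' (a * b) = a * D' b + b * D' a)
    (hD'comp : ∀ g : DP K n, D' (toKK 𝔓 g) = toKK 𝔓 (D g)) :
    letI : Algebra K (KK K n 𝔓) :=
      ((algebraMap (DP K n ⧸ 𝔓) (KK K n 𝔓)).comp
        (algebraMap K (DP K n ⧸ 𝔓))).toAlgebra
    (∃ y : Fin (n - r) → KK K n 𝔓,
        AlgebraicIndependent K fun p : Fin (n - r) × ℕ => D'^[p.2] (y p.1)) ∧
      ∀ d : ℕ,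
        (∃ y : Fin d → KK K n 𝔓,
          AlgebraicIndependent K fun p : Fin d × ℕ => D'^[p.2] (y p.1)) → d ≤ n - r := by
  letI alg : Algebra K (KK K n 𝔓) :=
      ((algebraMap (DP K n ⧸ 𝔓) (KK K n 𝔓)).comp
        (algebraMap K (DP K n ⧸ 𝔓))).toAlgebra
  obtain ⟨_, hdiff, hfP, hminP⟩ := hmin
  let τ : DP K n →ₐ[K] KK K n 𝔓 := { toKK 𝔓 with commutes' := fun _ => rfl }
  have hτ : ∀ g, τ g = toKK 𝔓 g := fun _ => rfl
  have hτ0 : ∀ g, τ g = 0 ↔ g ∈ 𝔓 := by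
    intro g
    rw [hτ, toKK, RingHom.comp_apply,
      map_eq_zero_iff _ (IsFractionRing.injective (DP K n ⧸ 𝔓) (KK K n 𝔓)),
      Ideal.Quotient.eq_zero_iff_mem]
  have hit : ∀ t s, D^[s] (f t) ∈ 𝔓 := by
    intro t s
    induction s with
    | zero => exact hfP t
    | succ s ih => rw [Function.iterate_succ_apply']; exact hdiff _ ih
  refine DAEaux.final τ (AddMonoidHom.mk' D hD.map_add) f hrn hD.leibniz
    (fun a => ⟨_, hD.map_C a⟩) hD.map_X D' hD'add hD'mul hD'comp ?_ e ?_
    (fun t s => (hτ0 _).2 (hit t s)) ?_ ?_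
  · intro z
    obtain ⟨a, b, hb, rfl⟩ := IsFractionRing.div_surjective (A := DP K n ⧸ 𝔓) z
    obtain ⟨a, rfl⟩ := Ideal.Quotient.mk_surjective a
    obtain ⟨b, rfl⟩ := Ideal.Quotient.mk_surjective b
    refine ⟨a, b, ?_, rfl⟩
    intro h
    have h1 := Ideal.Quotient.eq_zero_iff_mem.2 ((hτ0 b).1 h)
    exact nonZeroDivisors.ne_zero hb h1
  · intro t
    refine mem_supported.2 fun v hv => Nat.lt_succ_of_le ?_
    have h1 : v.2 ≤ ordIn (f t) v.1 :=
      Finset.le_sup (f := fun v : Fin n × ℕ => v.2)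
        (Finset.mem_filter.2 ⟨Finset.mem_coe.1 hv, rfl⟩)
    have h2 : ordIn (f t) v.1 ≤ e := by
      rw [he]
      exact Finset.le_sup (f := fun p : Fin r × Fin n => ordIn (f p.1) p.2)
        (Finset.mem_univ (t, v.1))
    exact h1.trans h2
  · intro i hi
    exact DAEaux.li_rows (qrJac D f 𝔓 e i) (by rw [hqr i hi]; simp)
  · intro Q hQ hQD hQf hQ0 g hg
    have : Q = 𝔓 := hminP Q hQ hQD hQf fun g hg => (hτ0 g).1 (hQ0 g hg)
    rw [this]; exact (hτ0 g).1 hg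

end DAE
end
end
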